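/- (Conversion lemma) Let p,q > 1 satisfy 1/p + 1/q < 2/d if d ≥ 2. For each ω ∈ Ω_{p,q} there exists c(ω) ∈ (0,∞) such that for all bounded f: Z^d → [0,∞), limsup_{n→∞} (1/n) Σ_{k=0}^{n−1} E_ω^0[f(X_k)] ≤ c(ω) · limsup_{n→∞} |Λ_n|^{-1} Σ_{x∈Λ_n} f(x) π_ω(x). -/

import Mathlib

open MeasureTheory Filter Topology Matrix
open scoped ENNReal NNReal

noncomputable section

namespace DetCond

/-- Vertices of `ℤ^d`. -/
abbrev Vert (d : ℕ) := Fin d → ℤ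

/-- Index of the (unordered) nearest-neighbour edge `(x, x + e i)` of `ℤ^d`;
the set of these indices is in natural bijection with `E(ℤ^d)` modulo orientation. -/
abbrev EdgeIx (d : ℕ) := Vert d × Fin d

/-- The space `Ω = (0,∞)^{E(ℤ^d)}` of (symmetric) conductance configurations, with
its product topology and product σ-algebra. -/
abbrev EnvSp (d : ℕ) := {ω : EdgeIx d → ℝ // ∀ e, 0 < ω e}

/-- The `i`-th coordinate unit vector of `ℤ^d`. -/
def unitv (d : ℕ) (i : Fin d) : Vert d := fun j => if j = i then 1 else 0

/-- The translation `τ_x` acting on environments: `c_{τ_x ω}(y,z) = c_ω(y+x,z+x)`. -/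
def shift (d : ℕ) (x : Vert d) (ω : EnvSp d) : EnvSp d :=
  ⟨fun e => ω.1 (e.1 + x, e.2), fun e => ω.2 (e.1 + x, e.2)⟩

/-- The conductance `c_ω(x,y)`; it vanishes when `x,y` are not nearest neighbours
and is symmetric in `x,y` by construction. -/
def cnd (d : ℕ) (ω : EnvSp d) (x y : Vert d) : ℝ :=
  ∑ i, ((if y = x + unitv d i then ω.1 (x, i) else 0) +
        (if x = y + unitv d i then ω.1 (y, i) else 0))

/-- `π_ω(x) = Σ_{z : (x,z) ∈ E(ℤ^d)} c_ω(x,z)`. -/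
def piOf (d : ℕ) (ω : EnvSp d) (x : Vert d) : ℝ :=
  ∑ i, (ω.1 (x, i) + ω.1 (x - unitv d i, i))

/-- The box `Λ_r = [-r,r]^d ∩ ℤ^d`. -/
def box (d : ℕ) (r : ℝ) : Finset (Vert d) :=
  Fintype.piFinset fun _ : Fin d => Finset.Icc ⌈-r⌉ ⌊r⌋

/-- The nearest neighbours of `x` in `ℤ^d`. -/
def nbrs (d : ℕ) (x : Vert d) : Finset (Vert d) :=
  (Finset.univ.image fun i => x + unitv d i) ∪ (Finset.univ.image fun i => x - unitv d i)

/-- The set `E(Λ)` of edges incident with at least one vertex of `Λ`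
(one index per unordered edge). -/
def edgesIn (d : ℕ) (Λ : Finset (Vert d)) : Finset (EdgeIx d) :=
  Λ.biUnion fun x =>
    (Finset.univ.image fun i => (x, i)) ∪ (Finset.univ.image fun i => (x - unitv d i, i))

/-- Bounded functions on `Ω`. -/
def IsBdd (d : ℕ) (f : EnvSp d → ℝ) : Prop := ∃ M, ∀ ω, |f ω| ≤ M

/-- Local functions: `f` depends only on the coordinates in some finite set `B` of edges
and, viewed as a function of those coordinates, has compact support in `(0,∞)^B`. -/
def IsLocalFn (d : ℕ) (f : EnvSp d → ℝ) : Prop :=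
  ∃ B : Finset (EdgeIx d),
    (∀ ω₁ ω₂ : EnvSp d, (∀ e ∈ B, ω₁.1 e = ω₂.1 e) → f ω₁ = f ω₂) ∧
    ∃ a b : ℝ, 0 < a ∧ ∀ ω : EnvSp d, (∃ e ∈ B, ω.1 e < a ∨ b < ω.1 e) → f ω = 0

/-- `ℓ_ω(f) = L`, i.e. the block averages of the translates of `f` converge to `L`. -/
def avgTo (d : ℕ) (ω : EnvSp d) (f : EnvSp d → ℝ) (L : ℝ) : Prop :=
  Tendsto (fun n : ℕ => (∑ x ∈ box d (n : ℝ), f (shift d x ω)) / ((box d (n : ℝ)).card : ℝ))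
    atTop (𝓝 L)

/-- `ω` is averaging: `ℓ_ω(f)` exists for every continuous local `f`. -/
def Averaging (d : ℕ) (ω : EnvSp d) : Prop :=
  ∀ f : EnvSp d → ℝ, Continuous f → IsLocalFn d f → ∃ L, avgTo d ω f L

/-- `ω` is tempered, i.e. `ω ∈ Ω'`. -/
def Tempered (d : ℕ) (ω : EnvSp d) : Prop :=
  Tendsto (fun ε : ℝ =>
      limsup (fun n : ℕ =>
        (∑ e ∈ edgesIn d (box d (n : ℝ)),
            (if ε ≤ ω.1 e ∧ ω.1 e ≤ ε⁻¹ then (0:ℝ) else 1)) / (n : ℝ) ^ d) atTop)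
    (𝓝[>] 0) (𝓝 0)

/-- `P` is the measure `ℙ_ω` associated with an averaging tempered `ω`:
the unique probability measure whose expectation of every bounded continuous function
is the corresponding block-average limit `ℓ_ω(f)`. -/
def IsEnvLaw (d : ℕ) (ω : EnvSp d) (P : Measure (EnvSp d)) : Prop :=
  IsProbabilityMeasure P ∧
    ∀ f : EnvSp d → ℝ, Continuous f → IsBdd d f → avgTo d ω f (∫ ω', f ω' ∂P)

/-- Ergodicity of a measure on `Ω` with respect to the translations of `ℤ^d`. -/
def ErgodicEnv (d : ℕ) (P : Measure (EnvSp d)) : Prop :=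
  ∀ A : Set (EnvSp d), MeasurableSet A → (∀ x : Vert d, shift d x ⁻¹' A = A) →
    P A = 0 ∨ P A = 1

/-- `ω ∈ Ω⋆`: tempered, averaging, and the associated measure `ℙ_ω` is ergodic. -/
def InOmegaStar (d : ℕ) (ω : EnvSp d) : Prop :=
  Tempered d ω ∧ Averaging d ω ∧
    ∀ P : Measure (EnvSp d), IsEnvLaw d ω P → ErgodicEnv d P

/-- `ω ∈ Ω_{p,q}`. -/
def InOmegaPQ (d : ℕ) (p q : ℝ) (ω : EnvSp d) : Prop :=
  (∃ C : ℝ, ∀ n : ℕ, 1 ≤ n →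
      (∑ e ∈ edgesIn d (box d (n : ℝ)), ω.1 e ^ p) / (n : ℝ) ^ d ≤ C) ∧
  (∃ C : ℝ, ∀ n : ℕ, 1 ≤ n →
      (∑ e ∈ edgesIn d (box d (n : ℝ)), ω.1 e ^ (-q)) / (n : ℝ) ^ d ≤ C)

/-- The path space of the discrete-time walk. -/
abbrev Path (d : ℕ) := ℕ → Vert d

/-- One-step transition probabilities `𝖯_ω(x,y) = c_ω(x,y)/π_ω(x)`. -/
def transP (d : ℕ) (ω : EnvSp d) (x y : Vert d) : ℝ := cnd d ω x y / piOf d ω x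

/-- `μ` is the law `P_ω^{x₀}` of the random walk among the conductances `ω`
started at `x₀`: a probability measure on the path space with the prescribed
finite-dimensional (cylinder) probabilities. -/
def IsWalkLaw (d : ℕ) (ω : EnvSp d) (x₀ : Vert d) (μ : Measure (Path d)) : Prop :=
  IsProbabilityMeasure μ ∧
    ∀ (n : ℕ) (γ : ℕ → Vert d),
      μ {w | ∀ k ≤ n, w k = γ k} =
        (if γ 0 = x₀ then 1 else 0) *
          ∏ k ∈ Finset.range n, ENNReal.ofReal (transP d ω (γ k) (γ (k+1)))

/-- `n`-step transition probabilities of the discrete-time walk. -/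
def stepP (d : ℕ) (ω : EnvSp d) : ℕ → Vert d → Vert d → ℝ
  | 0, x, y => if x = y then 1 else 0
  | n+1, x, y => ∑ z ∈ nbrs d x, transP d ω x z * stepP d ω n z y

/-- `P_ω^x(Y_t = y)` for the constant-speed continuous-time walk `Y_t = X_{N(t)}`,
where `N` is an independent rate-1 Poisson process. -/
def ctP (d : ℕ) (ω : EnvSp d) (t : ℝ) (x y : Vert d) : ℝ :=
  ∑' k : ℕ, Real.exp (-t) * t ^ k / (Nat.factorial k : ℝ) * stepP d ω k x y

/-- The `ℓ¹`-norm of a vertex of `ℤ^d`. -/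
def l1 (d : ℕ) (x : Vert d) : ℝ := ∑ i, |(x i : ℝ)|

/-- A vertex of `ℤ^d` regarded as a point of `ℝ^d`. -/
def ivert (d : ℕ) (x : Vert d) : Fin d → ℝ := fun i => (x i : ℝ)

/-- The linearly interpolated diffusively rescaled walk `B^{(n)}`. -/
def BnProc (d : ℕ) (n : ℕ) (w : Path d) (t : ℝ) : Fin d → ℝ :=
  (Real.sqrt n)⁻¹ •
    (ivert d (w ⌊t * n⌋₊) +
      (t * n - (⌊t * n⌋₊ : ℝ)) • (ivert d (w (⌊t * n⌋₊ + 1)) - ivert d (w ⌊t * n⌋₊)))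


/-- The measure `ℚ_ω` obtained from `ℙ_ω` by tilting with `π(0)`. -/
def Qmeas (d : ℕ) (P : Measure (EnvSp d)) : Measure (EnvSp d) :=
  P.withDensity fun ω' => ENNReal.ofReal (piOf d ω' 0 / ∫ ω'', piOf d ω'' 0 ∂P)

/-- The inner product `⟨f,g⟩_{L²(πμ)}`. -/
def innerP (d : ℕ) (P : Measure (EnvSp d)) (f g : EnvSp d → ℝ) : ℝ :=
  ∫ ω', f ω' * g ω' * piOf d ω' 0 ∂P

/-- The Dirichlet pairing `⟨h, (−L)h⟩_{L²(πμ)}`. -/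
def quadL (d : ℕ) (P : Measure (EnvSp d)) (h : EnvSp d → ℝ) : ℝ :=
  ∫ ω', (∑ z ∈ nbrs d 0, cnd d ω' 0 z * (h ω' - h (shift d z ω'))) * h ω' ∂P

/-- The inner product of `L²(ν)`. -/
def innerQ (d : ℕ) (ν : Measure (EnvSp d)) (f g : EnvSp d → ℝ) : ℝ :=
  ∫ ω', f ω' * g ω' ∂ν

/-- The Dirichlet pairing `⟨h, (−L)h⟩_{L²(ν)}`. -/
def quadQ (d : ℕ) (ν : Measure (EnvSp d)) (h : EnvSp d → ℝ) : ℝ :=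
  ∫ ω', ((piOf d ω' 0)⁻¹ *
      ∑ z ∈ nbrs d 0, cnd d ω' 0 z * (h ω' - h (shift d z ω'))) * h ω' ∂ν

/-- The set whose supremum is the variational characterization
`⟨f,(−L)⁻¹f⟩_{L²(ν)} = sup_h [2⟨h,f⟩ − ⟨h,(−L)h⟩]` (over bounded continuous `h`);
`⟨f,(−L)⁻¹f⟩_{L²(ν)} < ∞` means this set is bounded above. -/
def invPairSet (d : ℕ) (ν : Measure (EnvSp d)) (f : EnvSp d → ℝ) : Set ℝ :=
  {r | ∃ h : EnvSp d → ℝ, Continuous h ∧ IsBdd d h ∧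
        r = 2 * innerQ d ν h f - quadQ d ν h}

/-- The function `f(ω) = π_ω(0)⁻¹ ∇⋆(c v)(ω)` built from a vector field `v`. -/
def fDiv (d : ℕ) (v : EnvSp d → Fin d → ℝ) (ω : EnvSp d) : ℝ :=
  (piOf d ω 0)⁻¹ *
    ∑ i, (cnd d ω 0 (unitv d i) * v ω i -
          cnd d ω (-(unitv d i)) 0 * v (shift d (-(unitv d i)) ω) i)

/-- The inner product of `ℓ²(Λ,π_ω)`. -/
def innerF (d : ℕ) (ω : EnvSp d) (Λ : Finset (Vert d)) (f g : Vert d → ℝ) : ℝ :=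
  ∑ x ∈ Λ, f x * g x * piOf d ω x

/-- The pairing `⟨h, (−𝖫_ω)h⟩_{ℓ²(Λ,π_ω)}` for `h` vanishing outside `Λ`. -/
def quadF (d : ℕ) (ω : EnvSp d) (Λ : Finset (Vert d)) (h : Vert d → ℝ) : ℝ :=
  ∑ x ∈ Λ, (∑ z ∈ nbrs d x, cnd d ω x z * (h x - h z)) * h x

/-- `⟨f, (−𝖫_ω)⁻¹_Λ f⟩_{ℓ²(Λ,π_ω)}` via its variational characterization
`sup_h [2⟨h,f⟩ − ⟨h,(−𝖫_ω)h⟩]` over `h ∈ ℓ²(Λ,π_ω)`. -/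
def invPairF (d : ℕ) (ω : EnvSp d) (Λ : Finset (Vert d)) (f : Vert d → ℝ) : ℝ :=
  sSup {r | ∃ h : Vert d → ℝ, (∀ x ∉ Λ, h x = 0) ∧
      r = 2 * innerF d ω Λ h f - quadF d ω Λ h}

/-- The antisymmetric edge function `v∘τ(ω)`: the value assigned to the
edge `(x, x+e_i)` is `v_i(τ_x(ω))`. -/
def efield (d : ℕ) (v : EnvSp d → Fin d → ℝ) (ω : EnvSp d) : Vert d → Fin d → ℝ :=
  fun x i => v (shift d x ω) i

/-- The discrete gradient `∇h` of `h : ℤ^d → ℝ` as an edge function. -/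
def dgradE (d : ℕ) (h : Vert d → ℝ) : Vert d → Fin d → ℝ :=
  fun x i => h (x + unitv d i) - h x

/-- The inner product `⟨u,w⟩_{ℓ²(E(Λ), c_ω)}` of (antisymmetric) edge functions;
each unordered edge is counted once, which agrees with the paper's sum over
ordered edges carrying the factor ½. -/
def einner (d : ℕ) (ω : EnvSp d) (Λ : Finset (Vert d)) (u w : Vert d → Fin d → ℝ) : ℝ :=
  ∑ e ∈ edgesIn d Λ, u e.1 e.2 * w e.1 e.2 * ω.1 e

/-- The Dirichlet energy `𝓔_Λ^ω(v)`. -/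
def direnergy (d : ℕ) (ω : EnvSp d) (Λ : Finset (Vert d)) (v : EnvSp d → Fin d → ℝ) : ℝ :=
  sInf {r | ∃ h : Vert d → ℝ, (∀ x ∉ Λ, h x = 0) ∧
      r = einner d ω Λ (fun x i => efield d v ω x i - dgradE d h x i)
            (fun x i => efield d v ω x i - dgradE d h x i)}

/-- The gradient `∇h` of a function on `Ω`. -/
def gradOmega (d : ℕ) (h : EnvSp d → ℝ) : EnvSp d → Fin d → ℝ :=
  fun ω i => h (shift d (unitv d i) ω) - h ω

/-- The inner product `⟨u, c w⟩_{L²(P,ℝ^d)}`. -/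
def cinnerP (d : ℕ) (P : Measure (EnvSp d)) (u w : EnvSp d → Fin d → ℝ) : ℝ :=
  ∑ i, ∫ ω', cnd d ω' 0 (unitv d i) * u ω' i * w ω' i ∂P

/-- Bounded vector fields on `Ω`. -/
def IsBddV (d : ℕ) (v : EnvSp d → Fin d → ℝ) : Prop := ∃ M, ∀ ω i, |v ω i| ≤ M

/-- The space `𝒱 = (ℝ^d)^{ℤ^d}` of vector fields on `ℤ^d`. -/
abbrev VS (d : ℕ) := Vert d → Fin d → ℝ

/-- The empirical measures `μ_r^{ω,v}` built from the minimizers `h_r` of the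
finite-volume Dirichlet energies. -/
def muR (d : ℕ) (ω : EnvSp d) (hr : ℕ → Vert d → ℝ) (r : ℕ) :
    Measure (EnvSp d × VS d) :=
  (((box d ((r : ℝ) + Real.sqrt r)).card : ℝ≥0∞) *
      ((box d (Real.sqrt r)).card : ℝ≥0∞))⁻¹ •
    ∑ z ∈ box d (Real.sqrt r), ∑ x ∈ box d ((r : ℝ) + Real.sqrt r),
      Measure.dirac (shift d (x + z) ω, fun y => dgradE d (hr r) (x + z + y))

/-- The localized conductances `c_ω^R`. -/
def cR (d : ℕ) (ω : EnvSp d) (R : ℝ) (e : EdgeIx d) : ℝ :=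
  if e ∈ edgesIn d (box d (2 * R)) then ω.1 e else 1

/-- The localized measure `π_ω^R`. -/
def piRloc (d : ℕ) (ω : EnvSp d) (R : ℝ) (x : Vert d) : ℝ :=
  if x ∈ box d (2 * R) then piOf d ω x
  else if x ∈ box d (4 * R) then 1 + piOf d ω x else 1

/-- The localized Dirichlet form `D_ω^R(f,f)` (each unordered edge counted once). -/
def DR (d : ℕ) (ω : EnvSp d) (R : ℝ) (f : Vert d → ℝ) : ℝ≥0∞ :=
  ∑' e : EdgeIx d, ENNReal.ofReal (cR d ω R e * (f (e.1 + unitv d e.2) - f e.1) ^ 2)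

/-- The norm `‖f‖_{ℓ^s(μ)}`. -/
def lpN (d : ℕ) (μw : Vert d → ℝ) (s : ℝ) (f : Vert d → ℝ) : ℝ≥0∞ :=
  (∑' x : Vert d, ENNReal.ofReal (|f x| ^ s * μw x)) ^ (1 / s)

/-- The exponent `ε = 2(2/d − 1/p − 1/q)((d−2)/d + 1/q)⁻¹`. -/
def epsPQ (d : ℕ) (p q : ℝ) : ℝ :=
  2 * (2 / (d : ℝ) - 1 / p - 1 / q) / (((d : ℝ) - 2) / (d : ℝ) + 1 / q)

/-- Jump rates of the localized constant-speed chain `Y^R`: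
rate `c_ω^R(x,y)/π_ω^R(x)` from `x` to `y`. -/
def rateR (d : ℕ) (ω : EnvSp d) (R : ℝ) (x y : Vert d) : ℝ :=
  (∑ i, ((if y = x + unitv d i then cR d ω R (x, i) else 0) +
         (if x = y + unitv d i then cR d ω R (y, i) else 0))) / piRloc d ω R x

/-- The generator matrix of `Y^R`. -/
def qmatR (d : ℕ) (ω : EnvSp d) (R : ℝ) (x y : Vert d) : ℝ :=
  if x = y then -(∑ z ∈ nbrs d x, rateR d ω R x z) else rateR d ω R x y

/-- Iterates of the generator matrix of `Y^R`. -/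
def qiter (d : ℕ) (ω : EnvSp d) (R : ℝ) : ℕ → Vert d → Vert d → ℝ
  | 0, x, y => if x = y then 1 else 0
  | n+1, x, y => ∑ z ∈ insert x (nbrs d x), qmatR d ω R x z * qiter d ω R n z y

/-- The heat kernel `P_ω^x(Y_t^R = y) = (e^{tQ})(x,y)` of the localized chain `Y^R`. -/
def hkR (d : ℕ) (ω : EnvSp d) (R : ℝ) (t : ℝ) (x y : Vert d) : ℝ :=
  ∑' k : ℕ, t ^ k / (Nat.factorial k : ℝ) * qiter d ω R k x y

theorem pi_count_singleton {d : ℕ} (x : Vert d) :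
    Measure.pi (fun _ : Fin d => (Measure.count : Measure ℤ)) {x} = 1 := by
  rw [Measure.pi_singleton]; simp

/-- Grid-lines inequality on `ℤ^d`. -/
theorem tsum_rpow_le_of_le_grid_lines {d : ℕ} {r : ℝ} (hr0 : 0 ≤ r) (hr : ((d : ℝ) - 1) * r ≤ 1)
    {N : ℝ≥0∞} {f h : Vert d → ℝ≥0∞} (hfh : ∀ x, h x ≤ N * f x)
    (hline : ∀ x i, h x ≤ ∑' t : ℤ, f (Function.update x i t)) :
    ∑' x, h x ^ (1 + r) ≤ N ^ (1 - ((d : ℝ) - 1) * r) * (∑' x, f x) ^ (1 + r) := by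
  have key := lintegral_mul_prod_lintegral_pow_le
    (fun _ : Fin d => (Measure.count : Measure ℤ)) hr0 (by simpa using hr)
    (f := f) (measurable_of_countable f)
  simp only [lintegral_countable', pi_count_singleton, Measure.count_singleton, mul_one,
    Fintype.card_fin] at key
  have hs : 0 ≤ 1 - ((d : ℝ) - 1) * r := by linarith
  calc ∑' x, h x ^ (1 + r)
      ≤ ∑' x, N ^ (1 - ((d : ℝ) - 1) * r) * (f x ^ (1 - ((d : ℝ) - 1) * r) *
          ∏ i, (∑' t : ℤ, f (Function.update x i t)) ^ r) := by
        refine ENNReal.tsum_le_tsum fun x => ?_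
        have e : (1 + r) = (1 - ((d : ℝ) - 1) * r) + r * d := by ring
        rw [e, ENNReal.rpow_add_of_nonneg _ _ hs (by positivity), ← mul_assoc,
          ← ENNReal.mul_rpow_of_nonneg _ _ hs]
        refine mul_le_mul' (ENNReal.rpow_le_rpow (hfh x) hs) ?_
        rw [ENNReal.rpow_mul, ENNReal.rpow_natCast]
        calc (h x ^ r) ^ d = ∏ _i : Fin d, h x ^ r := by simp
          _ ≤ _ := Finset.prod_le_prod' fun i _ => ENNReal.rpow_le_rpow (hline x i) hr0
    _ ≤ _ := by
        rw [ENNReal.tsum_mul_left]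
        exact mul_le_mul' le_rfl key

theorem update_eq_add_smul_unitv {d : ℕ} (x : Vert d) (i : Fin d) (t : ℤ) :
    Function.update x i t = x + (t - x i) • unitv d i := by
  ext j
  by_cases h : j = i
  · subst h; simp [unitv]
  · simp [unitv, h]

theorem ofReal_le_tsum_line {d : ℕ} {h : Vert d → ℝ} {f : Vert d → ℝ} {Q : Finset (Vert d)}
    (hQ : ∀ x, h x ≠ 0 → x ∈ Q) (i : Fin d)
    (hf : ∀ x, |h (x + unitv d i) - h x| ≤ f x) (x : Vert d) :
    ENNReal.ofReal (h x) ≤ ∑' t : ℤ, ENNReal.ofReal (f (Function.update x i t)) := by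
  have hfin : ∃ n : ℕ, h (x + (n : ℤ) • unitv d i) = 0 := by
    by_contra! hc
    have hinj : Function.Injective fun n : ℕ => x + (n : ℤ) • unitv d i := by
      intro a b hab
      have := congrFun hab i
      simpa [unitv] using this
    exact (Set.infinite_range_of_injective hinj)
      (Q.finite_toSet.subset (by rintro _ ⟨n, rfl⟩; exact hQ _ (hc n)))
  obtain ⟨n, hn⟩ := hfin
  have htel : ∀ m : ℕ, h x - h (x + (m : ℤ) • unitv d i) ≤
      ∑ k ∈ Finset.range m, f (x + (k : ℤ) • unitv d i) := by
    intro m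
    induction m with
    | zero => simp
    | succ m ih =>
      rw [Finset.sum_range_succ]
      have h1 := hf (x + (m : ℤ) • unitv d i)
      have h2 : x + (m : ℤ) • unitv d i + unitv d i = x + ((m + 1 : ℕ) : ℤ) • unitv d i := by
        push_cast; rw [add_smul, one_smul, add_assoc]
      rw [h2] at h1
      have := (abs_le.1 h1).1
      linarith
  have hf0 : ∀ y, 0 ≤ f y := fun y => (abs_nonneg _).trans (hf y)
  have h1 := htel n
  rw [hn, sub_zero] at h1
  calc ENNReal.ofReal (h x)
      ≤ ENNReal.ofReal (∑ k ∈ Finset.range n, f (x + (k : ℤ) • unitv d i)) :=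
        ENNReal.ofReal_le_ofReal h1
    _ = ∑ k ∈ Finset.range n, ENNReal.ofReal (f (x + (k : ℤ) • unitv d i)) :=
        ENNReal.ofReal_sum_of_nonneg fun k _ => hf0 _
    _ = ∑ k ∈ Finset.range n, ENNReal.ofReal (f (Function.update x i (x i + k))) := by
        refine Finset.sum_congr rfl fun k _ => ?_
        rw [update_eq_add_smul_unitv]; simp
    _ ≤ ∑' k : ℕ, ENNReal.ofReal (f (Function.update x i (x i + k))) := ENNReal.sum_le_tsum _
    _ ≤ _ := ENNReal.tsum_comp_le_tsum_of_injective (f := fun k : ℕ => x i + (k : ℤ))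
        (fun a b hab => by simpa using hab) (fun t => ENNReal.ofReal (f (Function.update x i t)))

/-- Discrete Gagliardo–Nirenberg–Sobolev inequality with a zeroth-order term. -/
theorem sum_rpow_le_sobolev {d : ℕ} (hd : 1 ≤ d) {r : ℝ} (hr0 : 0 ≤ r)
    (hr : ((d : ℝ) - 1) * r ≤ 1) {N : ℝ} (hN : 0 < N) {h : Vert d → ℝ} (h0 : ∀ x, 0 ≤ h x)
    {Q : Finset (Vert d)} (hQ : ∀ x, h x ≠ 0 → x ∈ Q ∧ ∀ i, x - unitv d i ∈ Q) :
    ∑ x ∈ Q, h x ^ (1 + r) ≤ N ^ (1 - ((d : ℝ) - 1) * r) *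
      (∑ x ∈ Q, ∑ i, (|h (x + unitv d i) - h x| + h x / N)) ^ (1 + r) := by
  set f : Vert d → ℝ := fun x => ∑ i, (|h (x + unitv d i) - h x| + h x / N) with hfdef
  have hterm : ∀ x i, 0 ≤ |h (x + unitv d i) - h x| + h x / N := fun x i => by
    have := h0 x; positivity
  have hf0 : ∀ x, 0 ≤ f x := fun x => Finset.sum_nonneg fun i _ => hterm x i
  have hsingle : ∀ x i, |h (x + unitv d i) - h x| + h x / N ≤ f x := fun x i =>
    Finset.single_le_sum (f := fun i => |h (x + unitv d i) - h x| + h x / N)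
      (fun i _ => hterm x i) (Finset.mem_univ i)
  have hfQ : ∀ x ∉ Q, f x = 0 := by
    intro x hx
    have h1 : h x = 0 := by
      by_contra hc; exact hx (hQ x hc).1
    refine Finset.sum_eq_zero fun i _ => ?_
    have h2 : h (x + unitv d i) = 0 := by
      by_contra hc
      have := (hQ _ hc).2 i
      rw [add_sub_cancel_right] at this
      exact hx this
    simp [h1, h2]
  have hs : 0 ≤ 1 - ((d : ℝ) - 1) * r := by linarith
  have hr1 : 0 ≤ 1 + r := by linarith
  have key := tsum_rpow_le_of_le_grid_lines (d := d) hr0 hr (N := ENNReal.ofReal N)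
    (f := fun x => ENNReal.ofReal (f x)) (h := fun x => ENNReal.ofReal (h x))
    (fun x => by
      rw [← ENNReal.ofReal_mul hN.le]
      refine ENNReal.ofReal_le_ofReal ?_
      have h1 := hsingle x ⟨0, hd⟩
      have h2 : h x / N ≤ f x := by
        have := abs_nonneg (h (x + unitv d ⟨0, hd⟩) - h x); linarith
      rw [div_le_iff₀ hN] at h2; linarith)
    (fun x i => ofReal_le_tsum_line (fun y hy => (hQ y hy).1) i (fun y => by
      have h1 := hsingle y i
      have : 0 ≤ h y / N := div_nonneg (h0 y) hN.le
      linarith) x)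
  rw [tsum_eq_sum (f := fun x => ENNReal.ofReal (f x)) (s := Q) (fun x hx => by simp [hfQ x hx]),
    ← ENNReal.ofReal_sum_of_nonneg (fun x _ => hf0 x),
    ENNReal.ofReal_rpow_of_nonneg (Finset.sum_nonneg fun x _ => hf0 x) hr1,
    ENNReal.ofReal_rpow_of_nonneg hN.le hs, ← ENNReal.ofReal_mul (by positivity)] at key
  have key2 := (ENNReal.sum_le_tsum Q).trans key
  simp only [ENNReal.ofReal_rpow_of_nonneg (h0 _) hr1] at key2
  rw [← ENNReal.ofReal_sum_of_nonneg (fun x _ => Real.rpow_nonneg (h0 x) _),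
    ENNReal.ofReal_le_ofReal_iff (mul_nonneg (Real.rpow_nonneg hN.le _)
      (Real.rpow_nonneg (Finset.sum_nonneg fun x _ => hf0 x) _))] at key2
  exact key2

theorem sum_rpow_mul_rpow_mul_rpow_le {ι : Type*} (s : Finset ι) {a b c : ι → ℝ}
    (ha : ∀ i ∈ s, 0 ≤ a i) (hb : ∀ i ∈ s, 0 ≤ b i) (hc : ∀ i ∈ s, 0 ≤ c i) {u v w : ℝ}
    (hu : 0 < u) (hv : 0 < v) (hw : 0 < w) (huvw : u + v + w = 1) :
    ∑ i ∈ s, a i ^ u * b i ^ v * c i ^ w ≤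
      (∑ i ∈ s, a i) ^ u * (∑ i ∈ s, b i) ^ v * (∑ i ∈ s, c i) ^ w := by
  have hA := Finset.sum_nonneg ha
  have hB := Finset.sum_nonneg hb
  have hC := Finset.sum_nonneg hc
  have hR : 0 ≤ (∑ i ∈ s, a i) ^ u * (∑ i ∈ s, b i) ^ v * (∑ i ∈ s, c i) ^ w := by positivity
  rcases hA.eq_or_lt with hA0 | hA0
  · refine (Finset.sum_eq_zero fun i hi => ?_).trans_le hR
    rw [(Finset.sum_eq_zero_iff_of_nonneg ha).1 hA0.symm i hi, Real.zero_rpow hu.ne']; simp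
  rcases hB.eq_or_lt with hB0 | hB0
  · refine (Finset.sum_eq_zero fun i hi => ?_).trans_le hR
    rw [(Finset.sum_eq_zero_iff_of_nonneg hb).1 hB0.symm i hi, Real.zero_rpow hv.ne']; simp
  rcases hC.eq_or_lt with hC0 | hC0
  · refine (Finset.sum_eq_zero fun i hi => ?_).trans_le hR
    rw [(Finset.sum_eq_zero_iff_of_nonneg hc).1 hC0.symm i hi, Real.zero_rpow hw.ne']; simp
  set A := ∑ i ∈ s, a i
  set B := ∑ i ∈ s, b i
  set C := ∑ i ∈ s, c i
  have hpos : 0 < A ^ u * B ^ v * C ^ w := by positivity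
  rw [← div_le_one hpos, Finset.sum_div]
  calc ∑ i ∈ s, a i ^ u * b i ^ v * c i ^ w / (A ^ u * B ^ v * C ^ w)
      ≤ ∑ i ∈ s, (u * (a i / A) + v * (b i / B) + w * (c i / C)) := by
        refine Finset.sum_le_sum fun i hi => ?_
        have := Real.geom_mean_le_arith_mean3_weighted hu.le hv.le hw.le
          (div_nonneg (ha i hi) hA) (div_nonneg (hb i hi) hB) (div_nonneg (hc i hi) hC) huvw
        rw [Real.div_rpow (ha i hi) hA, Real.div_rpow (hb i hi) hB,
          Real.div_rpow (hc i hi) hC] at this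
        refine le_of_eq_of_le ?_ this
        field_simp
    _ = 1 := by
        rw [Finset.sum_add_distrib, Finset.sum_add_distrib, ← Finset.mul_sum, ← Finset.mul_sum,
          ← Finset.mul_sum, ← Finset.sum_div, ← Finset.sum_div, ← Finset.sum_div,
          div_self hA0.ne', div_self hB0.ne', div_self hC0.ne']
        linarith

theorem sum_rpow_mul_rpow_le {ι : Type*} (s : Finset ι) {a b : ι → ℝ}
    (ha : ∀ i ∈ s, 0 ≤ a i) (hb : ∀ i ∈ s, 0 ≤ b i) {u v : ℝ}
    (hu : 0 < u) (hv : 0 < v) (huv : u + v = 1) :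
    ∑ i ∈ s, a i ^ u * b i ^ v ≤ (∑ i ∈ s, a i) ^ u * (∑ i ∈ s, b i) ^ v := by
  have hA := Finset.sum_nonneg ha
  have := sum_rpow_mul_rpow_mul_rpow_le s ha hb hb hu (half_pos hv) (half_pos hv) (by linarith)
  have e : ∀ x : ℝ, 0 ≤ x → x ^ (v / 2) * x ^ (v / 2) = x ^ v := fun x hx => by
    rw [← Real.rpow_add_of_nonneg hx (by linarith) (by linarith), add_halves]
  simp only [mul_assoc] at this
  rw [e _ (Finset.sum_nonneg hb)] at this
  refine le_of_eq_of_le (Finset.sum_congr rfl fun i hi => ?_) this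
  rw [e _ (hb i hi)]

theorem abs_rpow_sub_rpow_le {a b g : ℝ} (ha : 0 ≤ a) (hb : 0 ≤ b) (hg : 1 ≤ g) :
    |a ^ g - b ^ g| ≤ g * |a - b| * max a b ^ (g - 1) := by
  wlog hab : b ≤ a generalizing a b
  · have := this hb ha (le_of_not_ge hab)
    rwa [abs_sub_comm, abs_sub_comm a b, max_comm]
  rw [max_eq_left hab, abs_of_nonneg (sub_nonneg.2 hab),
    abs_of_nonneg (sub_nonneg.2 (Real.rpow_le_rpow hb hab (by linarith)))]
  rcases ha.eq_or_lt with h0 | h0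
  · have hb0 : b = 0 := le_antisymm (hab.trans h0.symm.le) hb
    subst hb0; subst h0; simp
  -- Bernoulli's inequality for `(b / a) ^ g`
  have h1 := one_add_mul_self_le_rpow_one_add (s := b / a - 1)
    (by have := div_nonneg hb ha; linarith) hg
  rw [add_sub_cancel, Real.div_rpow hb ha] at h1
  have hag : 0 < a ^ g := Real.rpow_pos_of_pos h0 g
  rw [le_div_iff₀ hag] at h1
  have h2 : a ^ g = a ^ (g - 1) * a := by
    rw [← Real.rpow_add_one h0.ne', sub_add_cancel]
  have h3 : (1 + g * (b / a - 1)) * a ^ g = a ^ g - g * (a - b) * a ^ (g - 1) := by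
    rw [h2]; field_simp; ring
  linarith

/-- Shift of the summation variable for a function supported in the finite set. -/
theorem sum_add_unitv {d : ℕ} {Q : Finset (Vert d)} {F : Vert d → ℝ} (i : Fin d)
    (hF : ∀ x, F x ≠ 0 → x ∈ Q ∧ x - unitv d i ∈ Q) :
    ∑ x ∈ Q, F (x + unitv d i) = ∑ x ∈ Q, F x := by
  have h1 : ∑ x ∈ Q, F (x + unitv d i) = ∑' x, F (x + unitv d i) := by
    refine (tsum_eq_sum fun x hx => ?_).symm
    by_contra hc
    have := (hF _ hc).2
    rw [add_sub_cancel_right] at this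
    exact hx this
  have h2 : ∑ x ∈ Q, F x = ∑' x, F x :=
    (tsum_eq_sum fun x hx => by by_contra hc; exact hx (hF _ hc).1).symm
  rw [h1, h2]
  exact (Equiv.addRight (unitv d i)).tsum_eq F

/-- The Dirichlet form with a killing term of scale `N`. -/
def massiveForm (d : ℕ) (ω : EnvSp d) (Q : Finset (Vert d)) (N : ℝ) (w : Vert d → ℝ) : ℝ :=
  ∑ x ∈ Q, ∑ i, ω.1 (x, i) * ((w (x + unitv d i) - w x) ^ 2 + w x ^ 2 / N ^ 2)

theorem massiveForm_nonneg {d : ℕ} (ω : EnvSp d) (Q : Finset (Vert d)) (N : ℝ)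
    (w : Vert d → ℝ) : 0 ≤ massiveForm d ω Q N w :=
  Finset.sum_nonneg fun x _ => Finset.sum_nonneg fun i _ =>
    mul_nonneg (ω.2 (x, i)).le (by positivity)

theorem piOf_nonneg {d : ℕ} (ω : EnvSp d) (x : Vert d) : 0 ≤ piOf d ω x :=
  Finset.sum_nonneg fun _ _ => (add_pos (ω.2 _) (ω.2 _)).le

theorem piOf_pos {d : ℕ} (hd : 1 ≤ d) (ω : EnvSp d) (x : Vert d) : 0 < piOf d ω x :=
  Finset.sum_pos (fun _ _ => add_pos (ω.2 _) (ω.2 _)) ⟨⟨0, hd⟩, Finset.mem_univ _⟩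

theorem sum_gradient_rpow_le {d : ℕ} {q g s : ℝ} (hq : 1 < q) (hg : 1 ≤ g)
    (hs : 0 < s) (hgs : g - 1 = s * (1 / 2 - 1 / (2 * q))) (ω : EnvSp d)
    {N : ℝ} (hN : 0 < N) {Q : Finset (Vert d)} {w : Vert d → ℝ} (w0 : ∀ x, 0 ≤ w x)
    (hw : ∀ x, w x ≠ 0 → x ∈ Q ∧ ∀ i, x - unitv d i ∈ Q) :
    ∑ x ∈ Q, ∑ i, (|w (x + unitv d i) ^ g - w x ^ g| + w x ^ g / N) ≤
      g * ((2 * massiveForm d ω Q N w) ^ (1 / 2 : ℝ) *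
        (∑ x ∈ Q, ∑ i, ω.1 (x, i) ^ (-q)) ^ (1 / (2 * q)) *
        (2 * d * ∑ x ∈ Q, w x ^ s) ^ (1 / 2 - 1 / (2 * q))) := by
  have hq' : 1 / (2 * q) < 1 / 2 := one_div_lt_one_div_of_lt (by norm_num) (by linarith)
  have hq0 : 0 < 1 / (2 * q) := by positivity
  set T := Q ×ˢ (Finset.univ : Finset (Fin d)) with hT
  have hm : ∀ e : Vert d × Fin d, 0 ≤ max (w (e.1 + unitv d e.2)) (w e.1) :=
    fun e => le_max_of_le_right (w0 _)
  have hden : ∀ e : Vert d × Fin d, 0 ≤ |w (e.1 + unitv d e.2) - w e.1| + w e.1 / N :=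
    fun e => add_nonneg (abs_nonneg _) (div_nonneg (w0 _) hN.le)
  have hold := sum_rpow_mul_rpow_mul_rpow_le T
    (a := fun e => ω.1 e * (|w (e.1 + unitv d e.2) - w e.1| + w e.1 / N) ^ 2)
    (b := fun e => ω.1 e ^ (-q))
    (c := fun e => max (w (e.1 + unitv d e.2)) (w e.1) ^ s)
    (fun e _ => mul_nonneg (ω.2 e).le (sq_nonneg _)) (fun e _ => Real.rpow_nonneg (ω.2 e).le _)
    (fun e _ => Real.rpow_nonneg (hm e) _) (u := 1 / 2) (v := 1 / (2 * q))
    (w := 1 / 2 - 1 / (2 * q)) (by norm_num) hq0 (by linarith) (by ring)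
  have hA : ∑ e ∈ T, ω.1 e * (|w (e.1 + unitv d e.2) - w e.1| + w e.1 / N) ^ 2 ≤
      2 * massiveForm d ω Q N w := by
    rw [massiveForm, hT, Finset.sum_product, Finset.mul_sum]
    refine Finset.sum_le_sum fun x _ => ?_
    rw [Finset.mul_sum]
    refine Finset.sum_le_sum fun i _ => ?_
    have h1 := add_sq_le (a := |w (x + unitv d i) - w x|) (b := w x / N)
    rw [sq_abs, div_pow] at h1
    have := mul_le_mul_of_nonneg_left h1 (ω.2 (x, i)).le
    linarith
  have hC : ∑ e ∈ T, max (w (e.1 + unitv d e.2)) (w e.1) ^ s ≤ 2 * d * ∑ x ∈ Q, w x ^ s := by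
    have hle : ∑ e ∈ T, max (w (e.1 + unitv d e.2)) (w e.1) ^ s ≤
        ∑ e ∈ T, (w (e.1 + unitv d e.2) ^ s + w e.1 ^ s) := by
      refine Finset.sum_le_sum fun e _ => ?_
      have h1 := Real.rpow_nonneg (w0 (e.1 + unitv d e.2)) s
      have h2 := Real.rpow_nonneg (w0 e.1) s
      rcases max_choice (w (e.1 + unitv d e.2)) (w e.1) with h | h <;> rw [h] <;> linarith
    refine hle.trans (le_of_eq ?_)
    rw [hT, Finset.sum_product_right]
    simp only [Finset.sum_add_distrib]
    have hsh : ∀ i : Fin d, ∑ x ∈ Q, w (x + unitv d i) ^ s = ∑ x ∈ Q, w x ^ s := fun i =>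
      sum_add_unitv (F := fun x => w x ^ s) i fun x hx =>
        have hne : w x ≠ 0 := fun h0 => hx (by simp [h0, Real.zero_rpow hs.ne'])
        ⟨(hw x hne).1, (hw x hne).2 i⟩
    simp only [hsh, Finset.sum_const, Finset.card_univ, Fintype.card_fin, nsmul_eq_mul]
    ring
  have hB : ∑ e ∈ T, ω.1 e ^ (-q) = ∑ x ∈ Q, ∑ i, ω.1 (x, i) ^ (-q) := by
    rw [hT, Finset.sum_product]
  rw [hB] at hold
  have hpt : ∀ e : Vert d × Fin d,
      |w (e.1 + unitv d e.2) ^ g - w e.1 ^ g| + w e.1 ^ g / N ≤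
      g * ((ω.1 e * (|w (e.1 + unitv d e.2) - w e.1| + w e.1 / N) ^ 2) ^ (1 / 2 : ℝ) *
        (ω.1 e ^ (-q)) ^ (1 / (2 * q)) *
        (max (w (e.1 + unitv d e.2)) (w e.1) ^ s) ^ (1 / 2 - 1 / (2 * q))) := by
    intro e
    have e1 : (ω.1 e * (|w (e.1 + unitv d e.2) - w e.1| + w e.1 / N) ^ 2) ^ (1 / 2 : ℝ) *
        (ω.1 e ^ (-q)) ^ (1 / (2 * q)) = |w (e.1 + unitv d e.2) - w e.1| + w e.1 / N := by
      rw [Real.mul_rpow (ω.2 e).le (sq_nonneg _), ← Real.rpow_mul (ω.2 e).le,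
        ← Real.sqrt_eq_rpow (_ ^ 2), Real.sqrt_sq (hden e), mul_right_comm,
        ← Real.rpow_add (ω.2 e)]
      have : (1 / 2 + -q * (1 / (2 * q)) : ℝ) = 0 := by field_simp; ring
      rw [this, Real.rpow_zero, one_mul]
    rw [e1, ← Real.rpow_mul (hm e), ← hgs]
    have h1 := abs_rpow_sub_rpow_le (w0 (e.1 + unitv d e.2)) (w0 e.1) hg
    have h2 : w e.1 ^ g ≤ g * w e.1 * max (w (e.1 + unitv d e.2)) (w e.1) ^ (g - 1) := by
      rcases (w0 e.1).eq_or_lt with h0 | h0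
      · rw [← h0, Real.zero_rpow (by linarith)]; simp
      · have h3 : w e.1 ^ g = w e.1 * w e.1 ^ (g - 1) := by
          rw [mul_comm, ← Real.rpow_add_one h0.ne', sub_add_cancel]
        rw [h3, mul_assoc]
        have h4 : w e.1 ^ (g - 1) ≤ max (w (e.1 + unitv d e.2)) (w e.1) ^ (g - 1) :=
          Real.rpow_le_rpow h0.le (le_max_right _ _) (by linarith)
        have h5 := mul_le_mul_of_nonneg_left h4 h0.le
        exact h5.trans (le_mul_of_one_le_left (mul_nonneg h0.le (Real.rpow_nonneg (hm e) _)) hg)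
    have h3 := div_le_div_of_nonneg_right h2 hN.le
    calc _ ≤ _ := add_le_add h1 h3
      _ = _ := by ring
  calc ∑ x ∈ Q, ∑ i, (|w (x + unitv d i) ^ g - w x ^ g| + w x ^ g / N)
      = ∑ e ∈ T, (|w (e.1 + unitv d e.2) ^ g - w e.1 ^ g| + w e.1 ^ g / N) := by
        rw [hT, Finset.sum_product]
    _ ≤ _ := Finset.sum_le_sum fun e _ => hpt e
    _ = _ := (Finset.mul_sum _ _ _).symm
    _ ≤ _ := mul_le_mul_of_nonneg_left hold (by linarith)
    _ ≤ _ := by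
        refine mul_le_mul_of_nonneg_left ?_ (by linarith)
        have hB0 : 0 ≤ ∑ x ∈ Q, ∑ i, ω.1 (x, i) ^ (-q) :=
          Finset.sum_nonneg fun x _ => Finset.sum_nonneg fun i _ => Real.rpow_nonneg (ω.2 _).le _
        have hA0 : 0 ≤ ∑ e ∈ T, ω.1 e * (|w (e.1 + unitv d e.2) - w e.1| + w e.1 / N) ^ 2 :=
          Finset.sum_nonneg fun e _ => mul_nonneg (ω.2 e).le (sq_nonneg _)
        have hC0 : 0 ≤ ∑ e ∈ T, max (w (e.1 + unitv d e.2)) (w e.1) ^ s :=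
          Finset.sum_nonneg fun e _ => Real.rpow_nonneg (hm e) _
        have hM := massiveForm_nonneg ω Q N w
        have := Real.rpow_le_rpow hA0 hA (by norm_num : (0:ℝ) ≤ 1 / 2)
        have := Real.rpow_le_rpow hC0 hC (by linarith : (0:ℝ) ≤ 1 / 2 - 1 / (2 * q))
        gcongr

/-- Moment bounds of the conductances on a finite set of vertices at scale `N`. -/
structure MomentBound (d : ℕ) (p q K : ℝ) (ω : EnvSp d) (N : ℝ) (Q : Finset (Vert d)) : Prop where
  inv : ∑ x ∈ Q, ∑ i, ω.1 (x, i) ^ (-q) ≤ K * N ^ d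
  pi : ∑ x ∈ Q, piOf d ω x ^ p ≤ K * N ^ d

theorem exists_sobolev_exponent {d : ℕ} (hd : 1 ≤ d) {p q : ℝ} (hp : 1 < p) (hq : 1 < q)
    (hpq : 2 ≤ d → 1 / p + 1 / q < 2 / (d : ℝ)) :
    ∃ δ : ℝ, 0 < δ ∧ δ < 1 ∧ d * δ ≤ 1 ∧ δ < (1 + 1 / q) / 2 ∧ (1 / p + 1 / q) / 2 < δ := by
  have hp1 : 1 / p < 1 := by rw [div_lt_one (by linarith)]; exact hp
  have hq1 : 1 / q < 1 := by rw [div_lt_one (by linarith)]; exact hq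
  have hp0 : 0 < 1 / p := by positivity
  have hq0 : 0 < 1 / q := by positivity
  have hdpos : (0 : ℝ) < d := by exact_mod_cast hd
  have h1 : (1 / p + 1 / q) / 2 < 1 / (d : ℝ) := by
    rcases hd.eq_or_lt with h | h
    · subst h; norm_num at *; linarith
    · have := hpq h
      have e : 2 / (d : ℝ) = 2 * (1 / d) := by ring
      linarith
  obtain ⟨δ, hδ1, hδ2⟩ := exists_between
    (lt_min h1 (by linarith : (1 / p + 1 / q) / 2 < (1 + 1 / q) / 2))
  rw [lt_min_iff] at hδ2
  refine ⟨δ, by linarith, by linarith, ?_, hδ2.2, hδ1⟩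
  have := hδ2.1.le
  rw [le_div_iff₀ hdpos] at this
  linarith

theorem exists_weighted_sobolev {d : ℕ} (hd : 1 ≤ d) {p q : ℝ} (hp : 1 < p) (hq : 1 < q)
    (hpq : 2 ≤ d → 1 / p + 1 / q < 2 / (d : ℝ)) {K : ℝ} (hK : 0 < K) :
    ∃ ρ C : ℝ, 1 < ρ ∧ 0 < C ∧ ∀ (ω : EnvSp d) (N : ℝ) (Q : Finset (Vert d)) (w : Vert d → ℝ),
      0 < N → MomentBound d p q K ω N Q → (∀ x, 0 ≤ w x) →
      (∀ x, w x ≠ 0 → x ∈ Q ∧ ∀ i, x - unitv d i ∈ Q) →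
      ∑ x ∈ Q, piOf d ω x * w x ^ (2 * ρ) ≤
        N ^ d * (C * (N ^ 2 / N ^ d * massiveForm d ω Q N w)) ^ ρ := by
  obtain ⟨δ, hδ0, hδ1, hδd, hδq, hδpq⟩ := exists_sobolev_exponent hd hp hq hpq
  have hp1 : 1 / p < 1 := by rw [div_lt_one (by linarith)]; exact hp
  have hp0 : 0 < 1 / p := by positivity
  have hq0 : 0 < 1 / q := by positivity
  have hq' : 1 / (2 * q) = 1 / q / 2 := by field_simp
  have hq1 : 1 / q < 1 := by rw [div_lt_one (by linarith)]; exact hq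
  set σ : ℝ := (1 + 1 / q) / 2 - δ with hσ
  have hσ0 : 0 < σ := by linarith
  set g : ℝ := (1 - δ) / σ with hgdef
  set t : ℝ := 1 / 2 - 1 / (2 * q) with ht
  have ht0 : 0 < t := by rw [ht, hq']; linarith
  have hg : 1 ≤ g := by rw [hgdef, le_div_iff₀ hσ0]; linarith
  have hgt : g - 1 = 1 / σ * t := by
    rw [hgdef, ht, hq']; field_simp; rw [hσ]; field_simp; ring
  set ρ : ℝ := (1 - 1 / p) / (2 * σ) with hρdef
  have hρ : 1 < ρ := by rw [hρdef, lt_div_iff₀ (by linarith)]; linarith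
  have hρσ : σ * (2 * ρ) = 1 - 1 / p := by rw [hρdef]; field_simp
  set A : ℝ := 2 * g ^ 2 * K ^ (1 / q) * ((2 * d : ℝ) ^ t) ^ 2 with hA
  have hdpos : (0 : ℝ) < d := by exact_mod_cast hd
  have hA0 : 0 < A := by positivity
  refine ⟨ρ, K ^ (1 / (p * ρ)) * A, hρ, by positivity, ?_⟩
  intro ω N Q w hN hmom w0 hw
  set E := massiveForm d ω Q N w with hE
  have hE0 : 0 ≤ E := massiveForm_nonneg ω Q N w
  set V : ℝ := N ^ d with hV
  have hV0 : 0 < V := by positivity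
  set W := ∑ x ∈ Q, w x ^ (1 / σ) with hW
  have hW0 : 0 ≤ W := Finset.sum_nonneg fun x _ => Real.rpow_nonneg (w0 x) _
  -- the Sobolev inequality applied to `w ^ g`
  have hr0 : 0 ≤ δ / (1 - δ) := div_nonneg hδ0.le (by linarith)
  have h1δ : 0 < 1 - δ := by linarith
  have hsob := sum_rpow_le_sobolev hd hr0
    (by rw [← mul_div_assoc, div_le_one h1δ]; linarith) hN
    (h := fun x => w x ^ g) (fun x => Real.rpow_nonneg (w0 x) _) (Q := Q)
    (fun x hx => hw x fun h0 => hx (by simp [h0, Real.zero_rpow (by linarith : g ≠ 0)]))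
  have hgrad := sum_gradient_rpow_le hq hg (one_div_pos.2 hσ0) hgt ω hN w0 hw
  set G := ∑ x ∈ Q, ∑ i, (|w (x + unitv d i) ^ g - w x ^ g| + w x ^ g / N) with hG
  have hG0 : 0 ≤ G := Finset.sum_nonneg fun x _ => Finset.sum_nonneg fun i _ =>
    add_nonneg (abs_nonneg _) (div_nonneg (Real.rpow_nonneg (w0 x) _) hN.le)
  have e1 : ∀ x, (w x ^ g) ^ (1 + δ / (1 - δ)) = w x ^ (1 / σ) := fun x => by
    rw [← Real.rpow_mul (w0 x)]; congr 1; rw [hgdef]; field_simp; ring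
  simp only [e1] at hsob
  have hWG : W ^ (1 - δ) ≤ N * V ^ (-δ) * G := by
    have h1 := Real.rpow_le_rpow hW0 hsob h1δ.le
    rw [Real.mul_rpow (by positivity) (by positivity), ← Real.rpow_mul hN.le,
      ← Real.rpow_mul hG0] at h1
    have e2 : (1 + δ / (1 - δ)) * (1 - δ) = 1 := by field_simp; ring
    have e3 : (1 - ((d : ℝ) - 1) * (δ / (1 - δ))) * (1 - δ) = 1 + d * (-δ) := by
      field_simp; ring
    rw [e2, e3, Real.rpow_one, Real.rpow_add hN, Real.rpow_one, Real.rpow_mul hN.le,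
      Real.rpow_natCast] at h1
    exact h1
  have hWs : W ^ σ ≤ N * V ^ (-δ) *
      (g * ((2 * E) ^ (1 / 2 : ℝ) * (K * V) ^ (1 / (2 * q)) * (2 * d : ℝ) ^ t)) := by
    rcases hW0.eq_or_lt with h0 | h0
    · rw [← h0, Real.zero_rpow hσ0.ne']; positivity
    have hWt : 0 < W ^ t := Real.rpow_pos_of_pos h0 t
    have e4 : W ^ (1 - δ) = W ^ σ * W ^ t := by
      rw [← Real.rpow_add h0]; congr 1; rw [hσ, ht, hq']; ring
    refine le_of_mul_le_mul_right ?_ hWt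
    rw [← e4]
    refine hWG.trans ?_
    have hI0 : 0 ≤ ∑ x ∈ Q, ∑ i, ω.1 (x, i) ^ (-q) :=
      Finset.sum_nonneg fun x _ => Finset.sum_nonneg fun i _ => Real.rpow_nonneg (ω.2 _).le _
    have hI := Real.rpow_le_rpow hI0 hmom.inv (by positivity : 0 ≤ 1 / (2 * q))
    calc N * V ^ (-δ) * G
        ≤ N * V ^ (-δ) * (g * ((2 * E) ^ (1 / 2 : ℝ) * (K * V) ^ (1 / (2 * q)) *
          (2 * d * W) ^ t)) := by
          refine mul_le_mul_of_nonneg_left (hgrad.trans ?_) (by positivity)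
          gcongr
      _ = _ := by rw [Real.mul_rpow (by positivity) hW0]; ring
  -- passing to the weight `π`
  have hpi : ∑ x ∈ Q, piOf d ω x * w x ^ (2 * ρ) ≤ (K * V) ^ (1 / p) * (W ^ σ) ^ (2 * ρ) := by
    have h1 := sum_rpow_mul_rpow_le Q (a := fun x => piOf d ω x ^ p)
      (b := fun x => w x ^ (1 / σ)) (fun x _ => Real.rpow_nonneg (piOf_nonneg ω x) _)
      (fun x _ => Real.rpow_nonneg (w0 x) _) hp0 (sub_pos.2 hp1) (by ring)
    have e5 : ∀ x, (piOf d ω x ^ p) ^ (1 / p) * (w x ^ (1 / σ)) ^ (1 - 1 / p) =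
        piOf d ω x * w x ^ (2 * ρ) := fun x => by
      rw [← Real.rpow_mul (piOf_nonneg ω x), ← Real.rpow_mul (w0 x), mul_one_div_cancel
        (by linarith : p ≠ 0), Real.rpow_one, ← hρσ, ← mul_assoc, one_div_mul_cancel hσ0.ne',
        one_mul]
    simp only [e5] at h1
    refine h1.trans ?_
    rw [← Real.rpow_mul hW0, hρσ]
    exact mul_le_mul_of_nonneg_right (Real.rpow_le_rpow
      (Finset.sum_nonneg fun x _ => Real.rpow_nonneg (piOf_nonneg ω x) _) hmom.pi hp0.le)
      (Real.rpow_nonneg hW0 _)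
  refine hpi.trans ?_
  have hsq : (N * V ^ (-δ) *
      (g * ((2 * E) ^ (1 / 2 : ℝ) * (K * V) ^ (1 / (2 * q)) * (2 * d : ℝ) ^ t))) ^ 2 =
      A * (N ^ 2 / V * E) * V ^ (2 * σ) := by
    have a1 : ((2 * E) ^ (1 / 2 : ℝ)) ^ 2 = 2 * E := by
      rw [← Real.sqrt_eq_rpow, Real.sq_sqrt (by positivity)]
    have a2 : ((K * V) ^ (1 / (2 * q))) ^ 2 = K ^ (1 / q) * V ^ (1 / q) := by
      rw [← Real.rpow_natCast, ← Real.rpow_mul (by positivity), ← Real.mul_rpow hK.le hV0.le]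
      congr 1; push_cast; field_simp
    have a3 : (V ^ (-δ)) ^ 2 * V ^ (1 / q) = V ^ (2 * σ) / V := by
      rw [← Real.rpow_natCast, ← Real.rpow_mul hV0.le, ← Real.rpow_add hV0,
        ← Real.rpow_sub_one hV0.ne']
      congr 1; push_cast; rw [hσ]; ring
    simp only [mul_pow]
    rw [a1, a2, hA]
    calc _ = N ^ 2 * ((V ^ (-δ)) ^ 2 * V ^ (1 / q)) *
          (g ^ 2 * ((2 * E) * (K ^ (1 / q)) * ((2 * d : ℝ) ^ t) ^ 2)) := by ring
      _ = _ := by rw [a3]; ring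
  have h2 : (W ^ σ) ^ (2 * ρ) ≤ (A * (N ^ 2 / V * E) * V ^ (2 * σ)) ^ ρ := by
    rw [Real.rpow_mul (by positivity), ← hsq]
    refine Real.rpow_le_rpow (by positivity) ?_ (by linarith)
    rw [Real.rpow_two]
    exact pow_le_pow_left₀ (by positivity) hWs 2
  calc (K * V) ^ (1 / p) * (W ^ σ) ^ (2 * ρ)
      ≤ (K * V) ^ (1 / p) * (A * (N ^ 2 / V * E) * V ^ (2 * σ)) ^ ρ := by gcongr
    _ = _ := by
      have b1 : (V ^ (2 * σ)) ^ ρ * V ^ (1 / p) = V := by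
        rw [← Real.rpow_mul hV0.le, ← Real.rpow_add hV0]
        have : 2 * σ * ρ + 1 / p = 1 := by linarith
        rw [this, Real.rpow_one]
      have b2 : (K ^ (1 / (p * ρ))) ^ ρ = K ^ (1 / p) := by
        rw [← Real.rpow_mul hK.le]; congr 1; field_simp
      have b3 : (K ^ (1 / (p * ρ)) * (A * (N ^ 2 / V * E))) ^ ρ =
          K ^ (1 / p) * (A * (N ^ 2 / V * E)) ^ ρ := by
        rw [Real.mul_rpow (by positivity) (by positivity), b2]
      have b4 : (A * (N ^ 2 / V * E) * V ^ (2 * σ)) ^ ρ =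
          (A * (N ^ 2 / V * E)) ^ ρ * (V ^ (2 * σ)) ^ ρ :=
        Real.mul_rpow (by positivity) (by positivity)
      rw [mul_assoc (K ^ (1 / (p * ρ))), b3, b4, Real.mul_rpow hK.le hV0.le]
      calc _ = K ^ (1 / p) * (A * (N ^ 2 / V * E)) ^ ρ * ((V ^ (2 * σ)) ^ ρ * V ^ (1 / p)) := by
            ring
        _ = _ := by rw [b1]; ring

/-- `v` is subharmonic at `x` for the conductances `ω`. -/
def SubharmonicAt (d : ℕ) (ω : EnvSp d) (v : Vert d → ℝ) (x : Vert d) : Prop :=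
  piOf d ω x * v x ≤
    ∑ i, (ω.1 (x, i) * v (x + unitv d i) + ω.1 (x - unitv d i, i) * v (x - unitv d i))

theorem sum_sum_mul_add_unitv {d : ℕ} (ω : EnvSp d) {Q : Finset (Vert d)} {G : Vert d → ℝ}
    (hG : ∀ x, G x ≠ 0 → x ∈ Q ∧ ∀ i, x - unitv d i ∈ Q) :
    ∑ x ∈ Q, ∑ i, ω.1 (x, i) * (G x + G (x + unitv d i)) = ∑ x ∈ Q, piOf d ω x * G x := by
  have h : ∀ i, ∑ x ∈ Q, ω.1 (x, i) * G (x + unitv d i) =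
      ∑ x ∈ Q, ω.1 (x - unitv d i, i) * G x := fun i => by
    rw [← sum_add_unitv i (F := fun x => ω.1 (x - unitv d i, i) * G x)]
    · simp
    · intro x hx
      have := hG x (right_ne_zero_of_mul hx)
      exact ⟨this.1, this.2 i⟩
  calc _ = ∑ i, (∑ x ∈ Q, ω.1 (x, i) * G x + ∑ x ∈ Q, ω.1 (x, i) * G (x + unitv d i)) := by
        rw [Finset.sum_comm]
        simp only [mul_add, Finset.sum_add_distrib]
    _ = _ := by
        simp only [h, ← Finset.sum_add_distrib]
        rw [Finset.sum_comm]
        simp only [piOf, Finset.sum_mul, add_mul]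

theorem sum_sum_mul_sub_mul_sub {d : ℕ} (ω : EnvSp d) {Q : Finset (Vert d)} {v φ : Vert d → ℝ}
    (hφ : ∀ x, φ x ≠ 0 → x ∈ Q ∧ ∀ i, x - unitv d i ∈ Q) :
    ∑ x ∈ Q, ∑ i, ω.1 (x, i) * ((v (x + unitv d i) - v x) * (φ (x + unitv d i) - φ x)) =
      ∑ x ∈ Q, φ x * (piOf d ω x * v x -
        ∑ i, (ω.1 (x, i) * v (x + unitv d i) + ω.1 (x - unitv d i, i) * v (x - unitv d i))) := by
  have h : ∀ i, ∑ x ∈ Q, ω.1 (x, i) * (v (x + unitv d i) - v x) * φ (x + unitv d i) =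
      ∑ x ∈ Q, ω.1 (x - unitv d i, i) * (v x - v (x - unitv d i)) * φ x := fun i => by
    rw [← sum_add_unitv i
      (F := fun x => ω.1 (x - unitv d i, i) * (v x - v (x - unitv d i)) * φ x)]
    · simp
    · intro x hx
      have := hφ x (right_ne_zero_of_mul hx)
      exact ⟨this.1, this.2 i⟩
  calc _ = ∑ i, (∑ x ∈ Q, ω.1 (x, i) * (v (x + unitv d i) - v x) * φ (x + unitv d i) -
          ∑ x ∈ Q, ω.1 (x, i) * (v (x + unitv d i) - v x) * φ x) := by
        rw [Finset.sum_comm]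
        simp only [← Finset.sum_sub_distrib]
        refine Finset.sum_congr rfl fun i _ => Finset.sum_congr rfl fun x _ => by ring
    _ = _ := by
        simp only [h, ← Finset.sum_sub_distrib]
        rw [Finset.sum_comm]
        refine Finset.sum_congr rfl fun x _ => ?_
        simp only [piOf, Finset.sum_mul]
        rw [← Finset.sum_sub_distrib, Finset.mul_sum]
        refine Finset.sum_congr rfl fun i _ => by ring

/-- The Caccioppoli inequality. -/
theorem sum_gradient_mul_sq_le {d : ℕ} (ω : EnvSp d) {Q : Finset (Vert d)} {v η : Vert d → ℝ}
    (hv : ∀ x, 0 ≤ v x) (hη : ∀ x, η x ≠ 0 → x ∈ Q ∧ ∀ i, x - unitv d i ∈ Q)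
    (hsub : ∀ x, η x ≠ 0 → SubharmonicAt d ω v x) :
    ∑ x ∈ Q, ∑ i, ω.1 (x, i) *
        (η (x + unitv d i) * v (x + unitv d i) - η x * v x) ^ 2 ≤
      ∑ x ∈ Q, ∑ i, ω.1 (x, i) *
        (v x * v (x + unitv d i) * (η (x + unitv d i) - η x) ^ 2) := by
  have h := sum_sum_mul_sub_mul_sub ω (Q := Q) (v := v) (φ := fun x => η x ^ 2 * v x) (by
    intro x hx
    exact hη x fun h0 => hx (by simp [h0]))
  have h2 : ∑ x ∈ Q, η x ^ 2 * v x * (piOf d ω x * v x -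
      ∑ i, (ω.1 (x, i) * v (x + unitv d i) + ω.1 (x - unitv d i, i) * v (x - unitv d i))) ≤ 0 := by
    refine Finset.sum_nonpos fun x _ => ?_
    by_cases h0 : η x = 0
    · simp [h0]
    · exact mul_nonpos_of_nonneg_of_nonpos (mul_nonneg (sq_nonneg _) (hv x))
        (sub_nonpos.2 (hsub x h0))
  rw [← h] at h2
  rw [← sub_nonpos, ← Finset.sum_sub_distrib]
  refine le_of_eq_of_le ?_ h2
  refine Finset.sum_congr rfl fun x _ => ?_
  rw [← Finset.sum_sub_distrib]
  refine Finset.sum_congr rfl fun i _ => by ring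

theorem massiveForm_mul_le {d : ℕ} (ω : EnvSp d) {Q : Finset (Vert d)} {N B : ℝ}
    {v ψ ζ : Vert d → ℝ} (hv : ∀ x, 0 ≤ v x)
    (hψ : ∀ x, ψ x ≠ 0 → x ∈ Q ∧ ∀ i, x - unitv d i ∈ Q)
    (hζ : ∀ x, ζ x ≠ 0 → x ∈ Q ∧ ∀ i, x - unitv d i ∈ Q)
    (hsub : ∀ x, ψ x ≠ 0 → SubharmonicAt d ω v x) (hψ0 : ∀ x, 0 ≤ ψ x) (hψζ : ∀ x, ψ x ≤ ζ x)
    (hB : ∀ x i, |ψ (x + unitv d i) - ψ x| ≤ B * ζ x ∧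
      |ψ (x + unitv d i) - ψ x| ≤ B * ζ (x + unitv d i)) :
    massiveForm d ω Q N (fun x => ψ x * v x) ≤
      (B ^ 2 + 1 / N ^ 2) * ∑ x ∈ Q, piOf d ω x * (ζ x * v x) ^ 2 := by
  have hG : ∀ x, (ζ x * v x) ^ 2 ≠ 0 → x ∈ Q ∧ ∀ i, x - unitv d i ∈ Q := fun x hx =>
    hζ x fun h0 => hx (by simp [h0])
  rw [← sum_sum_mul_add_unitv ω hG]
  have hc := sum_gradient_mul_sq_le ω hv hψ hsub
  have h1 : massiveForm d ω Q N (fun x => ψ x * v x) = ∑ x ∈ Q, ∑ i, ω.1 (x, i) *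
        (ψ (x + unitv d i) * v (x + unitv d i) - ψ x * v x) ^ 2 +
      ∑ x ∈ Q, ∑ i, ω.1 (x, i) * ((ψ x * v x) ^ 2 / N ^ 2) := by
    simp only [massiveForm, mul_add, Finset.sum_add_distrib]
  rw [h1, add_mul, Finset.mul_sum, Finset.mul_sum]
  refine add_le_add (hc.trans ?_) ?_ <;> refine Finset.sum_le_sum fun x _ => ?_ <;>
    rw [Finset.mul_sum] <;> refine Finset.sum_le_sum fun i _ => ?_
  · rw [mul_left_comm (B ^ 2)]
    refine mul_le_mul_of_nonneg_left ?_ (ω.2 _).le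
    set D := ψ (x + unitv d i) - ψ x
    obtain ⟨b1, b2⟩ := hB x i
    have c1 : (v x * |D|) ≤ B * (ζ x * v x) := by nlinarith [hv x]
    have c2 : (v (x + unitv d i) * |D|) ≤ B * (ζ (x + unitv d i) * v (x + unitv d i)) := by
      nlinarith [hv (x + unitv d i)]
    have c3 := pow_le_pow_left₀ (mul_nonneg (hv x) (abs_nonneg D)) c1 2
    have c4 := pow_le_pow_left₀ (mul_nonneg (hv (x + unitv d i)) (abs_nonneg D)) c2 2
    have c5 : v x * v (x + unitv d i) * D ^ 2 = v x * |D| * (v (x + unitv d i) * |D|) := by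
      rw [← sq_abs D]; ring
    nlinarith [sq_nonneg (v x * |D| - v (x + unitv d i) * |D|), sq_nonneg (v x * |D|),
      sq_nonneg (v (x + unitv d i) * |D|)]
  · rw [mul_left_comm]
    refine mul_le_mul_of_nonneg_left ?_ (ω.2 _).le
    rw [div_eq_inv_mul, one_div]
    refine mul_le_mul_of_nonneg_left ?_ (by positivity)
    have := pow_le_pow_left₀ (mul_nonneg (hψ0 x) (hv x))
      (mul_le_mul_of_nonneg_right (hψζ x) (hv x)) 2
    nlinarith [sq_nonneg (ζ (x + unitv d i) * v (x + unitv d i))]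

theorem SubharmonicAt.rpow {d : ℕ} (hd : 1 ≤ d) {ω : EnvSp d} {u : Vert d → ℝ} {x : Vert d}
    (h : SubharmonicAt d ω u x) (hu : ∀ x, 0 ≤ u x) {α : ℝ} (hα : 1 ≤ α) :
    SubharmonicAt d ω (fun x => u x ^ α) x := by
  have hpi := piOf_pos hd ω x
  have key := Real.rpow_arith_mean_le_arith_mean_rpow (Finset.univ : Finset (Fin d × Bool))
    (fun j => if j.2 then ω.1 (x, j.1) / piOf d ω x else ω.1 (x - unitv d j.1, j.1) / piOf d ω x)
    (fun j => if j.2 then u (x + unitv d j.1) else u (x - unitv d j.1))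
    (fun j _ => by split_ifs <;> exact div_nonneg (ω.2 _).le hpi.le)
    (by
      rw [Fintype.sum_prod_type]
      simp only [Fintype.sum_bool, if_true, Bool.false_eq_true, if_false, ← add_div]
      rw [← Finset.sum_div]
      exact div_self hpi.ne')
    (fun j _ => by split_ifs <;> exact hu _) hα
  simp only [Fintype.sum_prod_type, Fintype.sum_bool, if_true, Bool.false_eq_true, if_false,
    div_mul_eq_mul_div, ← add_div] at key
  rw [← Finset.sum_div, ← Finset.sum_div] at key
  unfold SubharmonicAt at h ⊢
  rw [mul_comm, ← le_div_iff₀ hpi] at h ⊢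
  exact (Real.rpow_le_rpow (hu x) h (by linarith)).trans key

/-- The `ℓ^∞`-norm of a vertex of `ℤ^d`. -/
def supN {d : ℕ} (x : Vert d) : ℕ := Finset.univ.sup fun i => (x i).natAbs

theorem supN_le_iff {d : ℕ} {x : Vert d} {n : ℕ} : supN x ≤ n ↔ ∀ i, (x i).natAbs ≤ n := by
  simp [supN, Finset.sup_le_iff]

theorem natAbs_le_supN {d : ℕ} (x : Vert d) (i : Fin d) : (x i).natAbs ≤ supN x :=
  supN_le_iff.1 le_rfl i

theorem supN_add_le {d : ℕ} (x y : Vert d) : supN (x + y) ≤ supN x + supN y :=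
  supN_le_iff.2 fun i => (Int.natAbs_add_le _ _).trans
    (add_le_add (natAbs_le_supN x i) (natAbs_le_supN y i))

theorem supN_neg {d : ℕ} (x : Vert d) : supN (-x) = supN x := by
  simp [supN]

theorem supN_sub_le {d : ℕ} (x y : Vert d) : supN (x - y) ≤ supN x + supN y := by
  rw [sub_eq_add_neg, ← supN_neg y]
  exact supN_add_le _ _

theorem supN_zero {d : ℕ} : supN (0 : Vert d) = 0 :=
  Nat.le_zero.1 (supN_le_iff.2 fun i => by simp)

theorem supN_unitv_le {d : ℕ} (i : Fin d) : supN (unitv d i) ≤ 1 :=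
  supN_le_iff.2 fun j => by unfold unitv; split_ifs <;> simp

theorem supN_add_unitv_le {d : ℕ} (x : Vert d) (i : Fin d) :
    supN (x + unitv d i) ≤ supN x + 1 :=
  (supN_add_le _ _).trans (by have := supN_unitv_le i; omega)

theorem supN_sub_unitv_le {d : ℕ} (x : Vert d) (i : Fin d) :
    supN (x - unitv d i) ≤ supN x + 1 :=
  (supN_sub_le _ _).trans (by have := supN_unitv_le i; omega)

theorem supN_le_add_unitv {d : ℕ} (x : Vert d) (i : Fin d) :
    supN x ≤ supN (x + unitv d i) + 1 := by
  simpa using supN_sub_unitv_le (x + unitv d i) i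

/-- The `ℓ^∞`-ball of radius `m` around `x₀`. -/
def ball (d : ℕ) (x₀ : Vert d) (m : ℕ) : Finset (Vert d) :=
  Fintype.piFinset fun i => Finset.Icc (x₀ i - m) (x₀ i + m)

theorem mem_ball {d : ℕ} {x₀ x : Vert d} {m : ℕ} : x ∈ ball d x₀ m ↔ supN (x - x₀) ≤ m := by
  simp only [ball, Fintype.mem_piFinset, Finset.mem_Icc, supN_le_iff, Pi.sub_apply]
  exact forall_congr' fun i => by omega

theorem mem_box {d : ℕ} {x : Vert d} {n : ℕ} : x ∈ box d (n : ℝ) ↔ supN x ≤ n := by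
  have h : ⌈-(n : ℝ)⌉ = -(n : ℤ) := by rw [Int.ceil_neg, Int.floor_natCast]
  simp only [box, h, Int.floor_natCast, Fintype.mem_piFinset, Finset.mem_Icc, supN_le_iff]
  exact forall_congr' fun i => by omega

/-- A piecewise linear cutoff, vanishing at distance at least `N - j` from `x₀`. -/
def cutoff (d : ℕ) (x₀ : Vert d) (N j : ℕ) (x : Vert d) : ℝ :=
  ((N - j - supN (x - x₀) : ℕ) : ℝ) / N

theorem cutoff_nonneg {d : ℕ} (x₀ : Vert d) (N j : ℕ) (x : Vert d) : 0 ≤ cutoff d x₀ N j x :=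
  div_nonneg (Nat.cast_nonneg _) (Nat.cast_nonneg _)

theorem cutoff_le_one {d : ℕ} (x₀ : Vert d) (N j : ℕ) (x : Vert d) : cutoff d x₀ N j x ≤ 1 :=
  div_le_one_of_le₀ (by exact_mod_cast (by omega)) (Nat.cast_nonneg _)

theorem cutoff_ne_zero {d : ℕ} {x₀ : Vert d} {N j : ℕ} {x : Vert d}
    (h : cutoff d x₀ N j x ≠ 0) : supN (x - x₀) < N := by
  by_contra hc
  refine h ?_
  have : N - j - supN (x - x₀) = 0 := by omega
  simp [cutoff, this]

theorem cutoff_succ_le {d : ℕ} (x₀ : Vert d) (N j : ℕ) {x y : Vert d}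
    (h : supN (x - x₀) ≤ supN (y - x₀) + 1) : cutoff d x₀ N (j + 1) y ≤ cutoff d x₀ N j x := by
  refine div_le_div_of_nonneg_right ?_ (Nat.cast_nonneg _)
  exact_mod_cast (by omega : N - (j + 1) - supN (y - x₀) ≤ N - j - supN (x - x₀))

theorem abs_cutoff_sub_le {d : ℕ} (x₀ : Vert d) (N j : ℕ) {x y : Vert d}
    (h : supN (x - x₀) ≤ supN (y - x₀) + 1) (h' : supN (y - x₀) ≤ supN (x - x₀) + 1) :
    |cutoff d x₀ N j y - cutoff d x₀ N j x| ≤ 1 / N := by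
  unfold cutoff
  rw [← sub_div, abs_div, Nat.abs_cast]
  gcongr
  rw [abs_le]
  constructor
  · have : (N - j - supN (x - x₀) : ℕ) ≤ (N - j - supN (y - x₀) : ℕ) + 1 := by omega
    have : ((N - j - supN (x - x₀) : ℕ) : ℝ) ≤ (N - j - supN (y - x₀) : ℕ) + 1 := by
      exact_mod_cast this
    linarith
  · have : (N - j - supN (y - x₀) : ℕ) ≤ (N - j - supN (x - x₀) : ℕ) + 1 := by omega
    have : ((N - j - supN (y - x₀) : ℕ) : ℝ) ≤ (N - j - supN (x - x₀) : ℕ) + 1 := by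
      exact_mod_cast this
    linarith

theorem ball_of_supN_lt {d : ℕ} {x₀ x : Vert d} {N : ℕ} (h : supN (x - x₀) < N) :
    x ∈ ball d x₀ N ∧ ∀ i, x - unitv d i ∈ ball d x₀ N := by
  refine ⟨mem_ball.2 h.le, fun i => mem_ball.2 ?_⟩
  rw [sub_right_comm]
  exact (supN_sub_unitv_le _ _).trans h

/-- The normalized localized moments of `u` that are iterated in Moser's scheme. -/
def moserMoment (d : ℕ) (ω : EnvSp d) (x₀ : Vert d) (N : ℕ) (u : Vert d → ℝ) (α β : ℝ)
    (j : ℕ) : ℝ :=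
  (∑ x ∈ ball d x₀ N, piOf d ω x * (cutoff d x₀ N j x ^ β * u x ^ α) ^ 2) / (N : ℝ) ^ d

theorem moserMoment_nonneg {d : ℕ} (ω : EnvSp d) (x₀ : Vert d) (N : ℕ) (u : Vert d → ℝ)
    (α β : ℝ) (j : ℕ) : 0 ≤ moserMoment d ω x₀ N u α β j :=
  div_nonneg (Finset.sum_nonneg fun x _ => mul_nonneg (piOf_nonneg ω x) (sq_nonneg _))
    (by positivity)

theorem exists_moser_step {d : ℕ} (hd : 1 ≤ d) {p q : ℝ} (hp : 1 < p) (hq : 1 < q)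
    (hpq : 2 ≤ d → 1 / p + 1 / q < 2 / (d : ℝ)) {K : ℝ} (hK : 0 < K) :
    ∃ ρ C : ℝ, 1 < ρ ∧ 0 < C ∧ ∀ (ω : EnvSp d) (x₀ : Vert d) (N : ℕ) (u : Vert d → ℝ),
      0 < N → MomentBound d p q K ω N (ball d x₀ N) → (∀ x, 0 ≤ u x) →
      (∀ x, supN (x - x₀) < N → SubharmonicAt d ω u x) →
      ∀ (α β : ℝ) (j : ℕ), 1 ≤ α → 0 < β →
        moserMoment d ω x₀ N u (ρ * α) (ρ * (β + 1)) (j + 1) ≤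
          (C * (β + 1) ^ 2 * moserMoment d ω x₀ N u α β j) ^ ρ := by
  obtain ⟨ρ, C, hρ, hC, hS⟩ := exists_weighted_sobolev hd hp hq hpq hK
  refine ⟨ρ, 2 * C, hρ, by positivity, fun ω x₀ N u hN hmom hu hsub α β j hα hβ => ?_⟩
  have hNr : (0 : ℝ) < N := by exact_mod_cast hN
  set Q := ball d x₀ N
  set ψ : Vert d → ℝ := fun x => cutoff d x₀ N (j + 1) x ^ (β + 1) with hψ
  set ζ : Vert d → ℝ := fun x => cutoff d x₀ N j x ^ β with hζ
  set v : Vert d → ℝ := fun x => u x ^ α with hv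
  have hη := fun j x => cutoff_nonneg x₀ N j x
  have v0 : ∀ x, 0 ≤ v x := fun x => Real.rpow_nonneg (hu x) _
  have ψ0 : ∀ x, 0 ≤ ψ x := fun x => Real.rpow_nonneg (hη _ x) _
  have ψs : ∀ x, ψ x ≠ 0 → supN (x - x₀) < N := fun x hx =>
    cutoff_ne_zero (j := j + 1) fun h0 => hx (by
      simp only [hψ, h0]; exact Real.zero_rpow (by linarith))
  have ζs : ∀ x, ζ x ≠ 0 → supN (x - x₀) < N := fun x hx =>
    cutoff_ne_zero (j := j) fun h0 => hx (by simp only [hζ, h0]; exact Real.zero_rpow hβ.ne')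
  have hψζ : ∀ x, ψ x ≤ ζ x := fun x => by
    calc ψ x ≤ cutoff d x₀ N (j + 1) x ^ β :=
          Real.rpow_le_rpow_of_exponent_ge' (hη _ x) (cutoff_le_one _ _ _ x) hβ.le (by linarith)
      _ ≤ ζ x := Real.rpow_le_rpow (hη _ x) (cutoff_succ_le _ _ _ (by omega)) hβ.le
  have hdist : ∀ x i, supN (x + unitv d i - x₀) ≤ supN (x - x₀) + 1 ∧
      supN (x - x₀) ≤ supN (x + unitv d i - x₀) + 1 := fun x i => by
    rw [add_sub_right_comm]
    exact ⟨supN_add_unitv_le _ _, supN_le_add_unitv _ _⟩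
  have hB : ∀ x i, ∀ z, supN (z - x₀) ≤ supN (x - x₀) + 1 →
      supN (z - x₀) ≤ supN (x + unitv d i - x₀) + 1 →
      |ψ (x + unitv d i) - ψ x| ≤ (β + 1) / N * ζ z := fun x i z h1 h2 => by
    obtain ⟨h3, h4⟩ := hdist x i
    have h := abs_rpow_sub_rpow_le (hη (j + 1) (x + unitv d i)) (hη (j + 1) x)
      (g := β + 1) (by linarith)
    rw [add_sub_cancel_right] at h
    refine h.trans ?_
    have a1 := abs_cutoff_sub_le x₀ N (j + 1) h4 h3
    have a2 : max (cutoff d x₀ N (j + 1) (x + unitv d i)) (cutoff d x₀ N (j + 1) x) ^ β ≤ ζ z :=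
      Real.rpow_le_rpow (le_max_of_le_right (hη _ _))
        (max_le (cutoff_succ_le _ _ _ h2) (cutoff_succ_le _ _ _ h1)) hβ.le
    calc _ ≤ (β + 1) * (1 / N) * ζ z := by
          refine mul_le_mul (mul_le_mul_of_nonneg_left a1 (by linarith)) a2
            (Real.rpow_nonneg (le_max_of_le_right (hη _ _)) _) (by positivity)
      _ = _ := by ring
  have hE := massiveForm_mul_le ω (Q := Q) (N := N) (B := (β + 1) / N) (ψ := ψ) (ζ := ζ) v0
    (fun x hx => ball_of_supN_lt (ψs x hx)) (fun x hx => ball_of_supN_lt (ζs x hx))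
    (fun x hx => (hsub x (ψs x hx)).rpow hd hu hα) ψ0 hψζ
    (fun x i => ⟨hB x i x (by omega) (hdist x i).2, hB x i _ (hdist x i).1 (by omega)⟩)
  have hSw := hS ω N Q (fun x => ψ x * v x) hNr hmom (fun x => mul_nonneg (ψ0 x) (v0 x))
    (fun x hx => ball_of_supN_lt (ψs x (left_ne_zero_of_mul hx)))
  have e1 : ∀ x, (cutoff d x₀ N (j + 1) x ^ (ρ * (β + 1)) * u x ^ (ρ * α)) ^ 2 =
      (ψ x * v x) ^ (2 * ρ) := fun x => by
    rw [mul_comm ρ (β + 1), mul_comm ρ α, Real.rpow_mul (hη _ x), Real.rpow_mul (hu x),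
      ← Real.mul_rpow (ψ0 x) (v0 x), mul_comm 2 ρ, Real.rpow_mul (mul_nonneg (ψ0 x) (v0 x)),
      Real.rpow_two]
  rw [moserMoment, div_le_iff₀ (by positivity)]
  simp only [e1]
  refine hSw.trans ?_
  rw [mul_comm]
  refine mul_le_mul_of_nonneg_right (Real.rpow_le_rpow ?_ ?_ (by linarith)) (by positivity)
  · have := massiveForm_nonneg ω Q N (fun x => ψ x * v x)
    positivity
  · have hT : 0 ≤ ∑ x ∈ Q, piOf d ω x * (ζ x * v x) ^ 2 :=
      Finset.sum_nonneg fun x _ => mul_nonneg (piOf_nonneg ω x) (sq_nonneg _)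
    calc C * ((N : ℝ) ^ 2 / N ^ d * massiveForm d ω Q N (fun x => ψ x * v x))
        ≤ C * ((N : ℝ) ^ 2 / N ^ d * ((((β + 1) / N) ^ 2 + 1 / (N : ℝ) ^ 2) *
          ∑ x ∈ Q, piOf d ω x * (ζ x * v x) ^ 2)) := by gcongr
      _ = C * (((β + 1) ^ 2 + 1) * ((∑ x ∈ Q, piOf d ω x * (ζ x * v x) ^ 2) / N ^ d)) := by
          field_simp
      _ ≤ C * ((2 * (β + 1) ^ 2) * ((∑ x ∈ Q, piOf d ω x * (ζ x * v x) ^ 2) / N ^ d)) := by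
          gcongr
          nlinarith
      _ = _ := by simp only [moserMoment, hζ, hv, Q]; ring

theorem exists_iterate_le {ρ C : ℝ} (hρ : 1 < ρ) (hC : 0 < C) :
    ∃ a : ℝ, 0 < a ∧ ∀ S : ℕ → ℝ, (∀ j, 0 ≤ S j) →
      (∀ j, S (j + 1) ≤ (C * (ρ ^ j) ^ 2 * S j) ^ ρ) → ∀ j, S j ≤ a * (S 0 / a) ^ (ρ ^ j) := by
  have hρ0 : 0 < ρ := by linarith
  have hρ1 : 0 < ρ - 1 := by linarith
  set τ : ℝ := ρ ^ (2 * ρ / (ρ - 1)) with hτ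
  have hτ0 : 0 < τ := Real.rpow_pos_of_pos hρ0 _
  have hτ1 : 1 ≤ τ := Real.one_le_rpow hρ.le (by positivity)
  have hτρ : τ ^ ρ = τ * (ρ ^ 2) ^ ρ := by
    rw [← Real.rpow_natCast, ← Real.rpow_mul hρ0.le, hτ, ← Real.rpow_mul hρ0.le,
      ← Real.rpow_add hρ0]
    congr 1
    push_cast
    field_simp
    ring
  set a : ℝ := (C ^ ρ * τ) ^ (-(1 / (ρ - 1))) with ha
  have ha0 : 0 < a := by positivity
  have haρ : C ^ ρ * a ^ ρ * τ = a := by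
    have h1 : a ^ (ρ - 1) = (C ^ ρ * τ)⁻¹ := by
      rw [ha, ← Real.rpow_mul (by positivity), neg_mul, one_div_mul_cancel hρ1.ne',
        Real.rpow_neg_one]
    have h2 : a ^ ρ = a * a ^ (ρ - 1) := by
      rw [← Real.rpow_one_add' ha0.le (by linarith)]
      congr 1; ring
    rw [h2, h1]
    have : C ^ ρ ≠ 0 := by positivity
    field_simp
  refine ⟨a, ha0, fun S hS0 hS j => ?_⟩
  have hr : 0 ≤ S 0 / a := div_nonneg (hS0 0) ha0.le
  have key : ∀ j, S j ≤ a * (τ ^ j)⁻¹ * (S 0 / a) ^ (ρ ^ j) := fun j => by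
    induction j with
    | zero => simp only [pow_zero, inv_one, mul_one, Real.rpow_one]; field_simp; exact le_rfl
    | succ j ih =>
      refine (hS j).trans ?_
      have hX : 0 ≤ (S 0 / a) ^ (ρ ^ j) := Real.rpow_nonneg hr _
      calc (C * (ρ ^ j) ^ 2 * S j) ^ ρ
          ≤ (C * (ρ ^ j) ^ 2 * (a * (τ ^ j)⁻¹ * (S 0 / a) ^ (ρ ^ j))) ^ ρ := by
            refine Real.rpow_le_rpow (by have := hS0 j; positivity) ?_ hρ0.le
            gcongr
        _ = C ^ ρ * a ^ ρ * (((ρ ^ 2) ^ j) ^ ρ * ((τ ^ j) ^ ρ)⁻¹) * ((S 0 / a) ^ (ρ ^ j)) ^ ρ := by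
            rw [Real.mul_rpow (by positivity) (by positivity),
              Real.mul_rpow (by positivity) (by positivity),
              Real.mul_rpow (by positivity) hX, Real.mul_rpow ha0.le (by positivity),
              Real.inv_rpow (by positivity)]
            have : (ρ ^ j) ^ 2 = (ρ ^ 2) ^ j := by ring
            rw [this]
            ring
        _ = _ := by
            have e1 : ((ρ ^ 2) ^ j) ^ ρ = ((ρ ^ 2) ^ ρ) ^ j :=
              (Real.rpow_pow_comm (by positivity) _ _).symm
            have e2 : (τ ^ j) ^ ρ = (τ ^ ρ) ^ j := (Real.rpow_pow_comm hτ0.le _ _).symm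
            have e3 : ((S 0 / a) ^ (ρ ^ j)) ^ ρ = (S 0 / a) ^ (ρ ^ (j + 1)) := by
              rw [← Real.rpow_mul hr, pow_succ]
            have e4 : C ^ ρ * a ^ ρ = a * τ⁻¹ := by
              nth_rw 2 [← haρ]
              field_simp
            rw [e1, e2, e3, e4, hτρ, mul_pow, pow_succ τ]
            have : ((ρ ^ 2) ^ ρ) ^ j ≠ 0 := by positivity
            field_simp
  refine (key j).trans ?_
  refine mul_le_mul_of_nonneg_right ?_ (Real.rpow_nonneg hr _)
  exact mul_le_of_le_one_right ha0.le (inv_le_one_of_one_le₀ (one_le_pow₀ hτ1))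

theorem one_le_mul_piOf {d : ℕ} (hd : 1 ≤ d) {p q K : ℝ} (hq : 1 < q) (hK : 1 ≤ K)
    {ω : EnvSp d} {N : ℝ} (hN : 1 ≤ N) {Q : Finset (Vert d)} (h : MomentBound d p q K ω N Q)
    {x : Vert d} (hx : x ∈ Q) : 1 ≤ K * N ^ d * piOf d ω x := by
  let i : Fin d := ⟨0, hd⟩
  have h0 : ∀ x i, 0 ≤ ω.1 (x, i) ^ (-q) := fun x i => Real.rpow_nonneg (ω.2 _).le _
  have h1 : ω.1 (x, i) ^ (-q) ≤ K * N ^ d :=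
    ((Finset.single_le_sum (f := fun i => ω.1 (x, i) ^ (-q)) (fun i _ => h0 x i)
      (Finset.mem_univ i)).trans (Finset.single_le_sum
      (f := fun x => ∑ i, ω.1 (x, i) ^ (-q))
      (fun x _ => Finset.sum_nonneg fun i _ => h0 x i) hx)).trans h.inv
  have hc := ω.2 (x, i)
  have hKN : 1 ≤ K * N ^ d := one_le_mul_of_one_le_of_one_le hK (one_le_pow₀ hN)
  have h2 : ω.1 (x, i) ≤ piOf d ω x :=
    (le_add_of_nonneg_right (ω.2 _).le).trans (Finset.single_le_sum
      (f := fun i => ω.1 (x, i) + ω.1 (x - unitv d i, i))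
      (fun i _ => add_nonneg (ω.2 _).le (ω.2 _).le) (Finset.mem_univ i))
  have h3 : 1 ≤ K * N ^ d * ω.1 (x, i) := by
    by_contra! hlt
    have hc1 : ω.1 (x, i) ≤ 1 := by nlinarith
    have h4 : ω.1 (x, i) ^ (-1 : ℝ) ≤ ω.1 (x, i) ^ (-q) :=
      Real.rpow_le_rpow_of_exponent_ge hc hc1 (by linarith)
    rw [Real.rpow_neg_one] at h4
    have := mul_le_mul_of_nonneg_right (h4.trans h1) hc.le
    rw [inv_mul_cancel₀ hc.ne'] at this
    linarith
  exact h3.trans (mul_le_mul_of_nonneg_left h2 (by linarith))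

theorem exists_iteration_depth {ρ : ℝ} (hρ : 1 < ρ) (A : ℝ) (k : ℕ) :
    ∃ N₀ : ℕ, 0 < N₀ ∧ ∀ N : ℕ, N₀ ≤ N →
      ∃ J : ℕ, (2 * J) ^ 2 ≤ N ∧ A * (N : ℝ) ^ k ≤ 2 ^ (ρ ^ J) := by
  have h1 : ∀ᶠ J : ℕ in atTop, (J : ℝ) ≤ ρ ^ J := by
    have := tendsto_pow_const_div_const_pow_of_one_lt 1 hρ
    filter_upwards [this.eventually_le_const one_pos] with J hJ
    rw [div_le_one (by positivity)] at hJ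
    simpa using hJ
  have h2 : ∀ᶠ J : ℕ in atTop, |A| * 16 ^ k * (J : ℝ) ^ (2 * k) ≤ 2 ^ J := by
    have := (tendsto_pow_const_div_const_pow_of_one_lt (2 * k) (one_lt_two (α := ℝ))).const_mul
      (|A| * 16 ^ k)
    rw [mul_zero] at this
    filter_upwards [this.eventually_le_const one_pos] with J hJ
    rw [← mul_div_assoc, div_le_one (by positivity)] at hJ
    exact hJ
  have hJt : Tendsto (fun N : ℕ => N.sqrt / 2) atTop atTop := by
    refine tendsto_atTop.2 fun m => ?_
    filter_upwards [eventually_ge_atTop ((2 * m) * (2 * m))] with N hN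
    have := Nat.le_sqrt.2 hN
    omega
  obtain ⟨N₀, hN₀⟩ := eventually_atTop.1 (hJt.eventually
    ((h1.and h2).and (eventually_ge_atTop 1)))
  refine ⟨N₀ + 1, Nat.succ_pos _, fun N hN => ⟨N.sqrt / 2, ?_, ?_⟩⟩
  · have : 2 * (N.sqrt / 2) ≤ N.sqrt := Nat.mul_div_le _ _
    exact (Nat.pow_le_pow_left this 2).trans (Nat.sqrt_le' N)
  · obtain ⟨⟨a1, a2⟩, a3⟩ := hN₀ N (by omega)
    set J := N.sqrt / 2
    have b1 : N ≤ 16 * J ^ 2 := by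
      have : N.sqrt + 1 ≤ 4 * J := by omega
      have := Nat.lt_succ_sqrt N
      simp only [Nat.succ_eq_add_one] at this
      nlinarith
    have b2 : (N : ℝ) ≤ 16 * (J : ℝ) ^ 2 := by exact_mod_cast b1
    calc A * (N : ℝ) ^ k ≤ |A| * (16 * (J : ℝ) ^ 2) ^ k := by
          gcongr
          exact le_abs_self A
      _ = |A| * 16 ^ k * (J : ℝ) ^ (2 * k) := by rw [mul_pow, ← pow_mul]; ring
      _ ≤ 2 ^ J := a2
      _ = 2 ^ (J : ℝ) := (Real.rpow_natCast _ _).symm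
      _ ≤ 2 ^ (ρ ^ J) := Real.rpow_le_rpow_of_exponent_le one_le_two a1

theorem le_two_mul_of_mul_rpow_le {m y z n s : ℝ} (hn : 1 ≤ n) (hz : 0 ≤ z) (hm : 0 < m)
    (hy : 0 ≤ y) (h : m * y ^ n ≤ z ^ n * s) (hs : s ≤ m * 2 ^ n) : y ≤ 2 * z := by
  refine (Real.rpow_le_rpow_iff hy (by positivity) (by linarith : 0 < n)).1 ?_
  refine le_of_mul_le_mul_left ?_ hm
  rw [Real.mul_rpow zero_le_two hz]
  nlinarith [Real.rpow_nonneg hz n]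

/-- The local maximal inequality for nonnegative subharmonic functions. -/
theorem exists_mean_value_le {d : ℕ} (hd : 1 ≤ d) {p q : ℝ} (hp : 1 < p) (hq : 1 < q)
    (hpq : 2 ≤ d → 1 / p + 1 / q < 2 / (d : ℝ)) {K : ℝ} (hK : 1 ≤ K) :
    ∃ (C : ℝ) (N₀ : ℕ), 0 < C ∧ 0 < N₀ ∧ ∀ (ω : EnvSp d) (x₀ : Vert d) (N : ℕ) (u : Vert d → ℝ),
      N₀ ≤ N → MomentBound d p q K ω N (ball d x₀ N) → (∀ x, 0 ≤ u x) →
      (∀ x, supN (x - x₀) < N → SubharmonicAt d ω u x) →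
      u x₀ ≤ C * ((∑ x ∈ ball d x₀ N, piOf d ω x * u x) / (N : ℝ) ^ d) := by
  obtain ⟨ρ, C, hρ, hC, hstep⟩ := exists_moser_step hd hp hq hpq (by linarith : 0 < K)
  have hρ1 : 0 < ρ - 1 := by linarith
  set c₀ : ℝ := ρ / (ρ - 1) with hc₀
  have hc₀1 : 1 < c₀ := by rw [hc₀, lt_div_iff₀ hρ1]; linarith
  have hc₀ρ : ρ * (c₀ - 1) = c₀ := by rw [hc₀]; field_simp; ring
  set b : ℝ := max (2 * c₀) (4 * d) with hb
  have hb1 : 2 * c₀ ≤ b := le_max_left _ _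
  have hb2 : 4 * (d : ℝ) ≤ b := le_max_right _ _
  have hb0 : 0 < b := by linarith
  obtain ⟨a, ha, hiter⟩ := exists_iterate_le hρ (C := C * b ^ 2) (by positivity)
  obtain ⟨N₀, hN₀, hdepth⟩ := exists_iteration_depth hρ (a * K) (2 * d)
  refine ⟨max K (2 * 4 ^ b / a), N₀, lt_max_of_lt_left (by linarith), hN₀,
    fun ω x₀ N u hN hmom hu hsub => ?_⟩
  obtain ⟨J, hJ1, hJ2⟩ := hdepth N hN
  have hNn : 0 < N := by omega
  have hN1 : (1 : ℝ) ≤ N := by exact_mod_cast hNn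
  have hNr : (0 : ℝ) < N := by linarith
  set A := (∑ x ∈ ball d x₀ N, piOf d ω x * u x) / (N : ℝ) ^ d with hA
  have hpi := piOf_nonneg ω
  have hA0 : 0 ≤ A := div_nonneg (Finset.sum_nonneg fun x _ => mul_nonneg (hpi x) (hu x))
    (by positivity)
  have hη := cutoff_nonneg x₀ N
  have hη1 := cutoff_le_one x₀ N
  obtain ⟨x₁, hx₁, hmax⟩ := Finset.exists_max_image (ball d x₀ N)
    (fun x => u x * cutoff d x₀ N 0 x ^ b) ⟨x₀, mem_ball.2 (by simp [supN_zero])⟩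
  set M := u x₁ * cutoff d x₀ N 0 x₁ ^ b with hM
  have hM0 : 0 ≤ M := mul_nonneg (hu _) (Real.rpow_nonneg (hη _ _) _)
  have hx₀ : u x₀ ≤ M := by
    have := hmax x₀ (mem_ball.2 (by simp [supN_zero]))
    have h1 : cutoff d x₀ N 0 x₀ = 1 := by
      simp [cutoff, supN_zero, hNr.ne']
    simpa [h1] using this
  refine hx₀.trans ?_
  have hpi1 : 1 ≤ K * N ^ d * piOf d ω x₁ := one_le_mul_piOf hd hq hK hN1 hmom hx₁
  have hpi1' : 0 < piOf d ω x₁ := piOf_pos hd ω x₁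
  rcases le_or_gt (N - supN (x₁ - x₀)) (2 * J) with hθ | hθ
  · -- the maximum is attained near the boundary
    have h1 : piOf d ω x₁ * u x₁ ≤ A * N ^ d := by
      rw [hA, div_mul_cancel₀ _ (by positivity)]
      exact Finset.single_le_sum (f := fun x => piOf d ω x * u x)
        (fun x _ => mul_nonneg (hpi x) (hu x)) hx₁
    have h2 : u x₁ ≤ K * N ^ d * (A * N ^ d) := by
      calc u x₁ ≤ (K * N ^ d * piOf d ω x₁) * u x₁ := le_mul_of_one_le_left (hu _) hpi1
        _ = K * N ^ d * (piOf d ω x₁ * u x₁) := by ring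
        _ ≤ _ := mul_le_mul_of_nonneg_left h1 (by positivity)
    have h3 : cutoff d x₀ N 0 x₁ ^ 2 ≤ 1 / N := by
      rw [cutoff, div_pow, div_le_div_iff₀ (by positivity) hNr, one_mul]
      have : (N - 0 - supN (x₁ - x₀)) ^ 2 * N ≤ N ^ 2 := by
        rw [pow_two N]
        exact Nat.mul_le_mul_right _ ((Nat.pow_le_pow_left (by omega) 2).trans hJ1)
      exact_mod_cast this
    have h4 : cutoff d x₀ N 0 x₁ ^ b ≤ 1 / (N ^ d * N ^ d) := by
      calc cutoff d x₀ N 0 x₁ ^ b ≤ cutoff d x₀ N 0 x₁ ^ ((4 * d : ℕ) : ℝ) :=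
            Real.rpow_le_rpow_of_exponent_ge' (hη _ _) (hη1 _ _) (by positivity)
              (by push_cast; exact hb2)
        _ = (cutoff d x₀ N 0 x₁ ^ 2) ^ (2 * d) := by
            rw [Real.rpow_natCast, ← pow_mul]; congr 1; ring
        _ ≤ (1 / (N : ℝ)) ^ (2 * d) := pow_le_pow_left₀ (sq_nonneg _) h3 _
        _ = _ := by rw [div_pow, one_pow, two_mul, pow_add]
    calc M ≤ K * N ^ d * (A * N ^ d) * (1 / (N ^ d * N ^ d)) :=
          mul_le_mul h2 h4 (Real.rpow_nonneg (hη _ _) _) (by positivity)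
      _ = K * A := by field_simp
      _ ≤ _ := mul_le_mul_of_nonneg_right (le_max_left _ _) hA0
  · -- the maximum is attained in the interior
    set S : ℕ → ℝ := fun j => moserMoment d ω x₀ N u (ρ ^ j) (b * ρ ^ j - c₀) j with hS
    have hρj : ∀ j : ℕ, 1 ≤ ρ ^ j := fun j => one_le_pow₀ hρ.le
    have hSJ := hiter S (fun j => moserMoment_nonneg _ _ _ _ _ _ _) (fun j => by
      have hβ : 0 < b * ρ ^ j - c₀ := by nlinarith [hρj j]
      have h := hstep ω x₀ N u hNn hmom hu hsub (ρ ^ j) (b * ρ ^ j - c₀) j (hρj j) hβ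
      have e1 : ρ * ρ ^ j = ρ ^ (j + 1) := by ring
      have e2 : ρ * (b * ρ ^ j - c₀ + 1) = b * ρ ^ (j + 1) - c₀ := by
        rw [← e1]; linear_combination -hc₀ρ
      rw [e1, e2] at h
      refine h.trans (Real.rpow_le_rpow ?_ ?_ (by linarith))
      · have := moserMoment_nonneg ω x₀ N u (ρ ^ j) (b * ρ ^ j - c₀) j
        positivity
      · have h5 : (b * ρ ^ j - c₀ + 1) ^ 2 ≤ (b * ρ ^ j) ^ 2 :=
          pow_le_pow_left₀ (by linarith) (by linarith) 2
        calc _ ≤ C * (b * ρ ^ j) ^ 2 * moserMoment d ω x₀ N u (ρ ^ j) (b * ρ ^ j - c₀) j :=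
              mul_le_mul_of_nonneg_right (mul_le_mul_of_nonneg_left h5 hC.le)
                (moserMoment_nonneg _ _ _ _ _ _ _)
          _ = _ := by rw [mul_pow, ← mul_assoc]) J
    have hS0 : S 0 ≤ M * A := by
      simp only [hS, moserMoment, hA, pow_zero, mul_one, Real.rpow_one]
      rw [← mul_div_assoc, Finset.mul_sum]
      refine div_le_div_of_nonneg_right (Finset.sum_le_sum fun x hx => ?_) (by positivity)
      have h6 : (cutoff d x₀ N 0 x ^ (b - c₀)) ^ 2 ≤ cutoff d x₀ N 0 x ^ b := by
        rw [← Real.rpow_two, ← Real.rpow_mul (hη _ _)]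
        exact Real.rpow_le_rpow_of_exponent_ge' (hη _ _) (hη1 _ _) hb0.le (by linarith)
      calc piOf d ω x * (cutoff d x₀ N 0 x ^ (b - c₀) * u x) ^ 2
          = (piOf d ω x * u x) * (u x * (cutoff d x₀ N 0 x ^ (b - c₀)) ^ 2) := by ring
        _ ≤ (piOf d ω x * u x) * (u x * cutoff d x₀ N 0 x ^ b) :=
            mul_le_mul_of_nonneg_left (mul_le_mul_of_nonneg_left h6 (hu x))
              (mul_nonneg (hpi x) (hu x))
        _ ≤ (piOf d ω x * u x) * M := mul_le_mul_of_nonneg_left (hmax x hx)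
              (mul_nonneg (hpi x) (hu x))
        _ = _ := mul_comm _ _
    have hcut : cutoff d x₀ N 0 x₁ ≤ 2 * cutoff d x₀ N J x₁ := by
      unfold cutoff
      rw [← mul_div_assoc]
      refine div_le_div_of_nonneg_right ?_ hNr.le
      exact_mod_cast (by omega : N - 0 - supN (x₁ - x₀) ≤ 2 * (N - J - supN (x₁ - x₀)))
    set y := u x₁ * cutoff d x₀ N J x₁ ^ b with hy
    have hy0 : 0 ≤ y := mul_nonneg (hu _) (Real.rpow_nonneg (hη _ _) _)
    have hMy : M ≤ 2 ^ b * y := by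
      calc M ≤ u x₁ * (2 * cutoff d x₀ N J x₁) ^ b :=
            mul_le_mul_of_nonneg_left (Real.rpow_le_rpow (hη _ _) hcut hb0.le) (hu _)
        _ = _ := by rw [Real.mul_rpow zero_le_two (hη _ _)]; ring
    have hS0' : 0 ≤ S 0 := moserMoment_nonneg _ _ _ _ _ _ _
    have hpt : piOf d ω x₁ * (y ^ 2) ^ (ρ ^ J) ≤ (S 0 / a) ^ (ρ ^ J) * (a * N ^ d) := by
      have h7 : piOf d ω x₁ * (cutoff d x₀ N J x₁ ^ (b * ρ ^ J - c₀) * u x₁ ^ (ρ ^ J)) ^ 2 ≤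
          S J * N ^ d := by
        simp only [hS, moserMoment]
        rw [div_mul_cancel₀ _ (by positivity)]
        exact Finset.single_le_sum (f := fun x => piOf d ω x *
          (cutoff d x₀ N J x ^ (b * ρ ^ J - c₀) * u x ^ (ρ ^ J)) ^ 2)
          (fun x _ => mul_nonneg (hpi x) (sq_nonneg _)) hx₁
      have h8 : (y ^ 2) ^ (ρ ^ J) ≤
          (cutoff d x₀ N J x₁ ^ (b * ρ ^ J - c₀) * u x₁ ^ (ρ ^ J)) ^ 2 := by
        have e3 : (y ^ 2) ^ (ρ ^ J) = (cutoff d x₀ N J x₁ ^ (b * ρ ^ J) * u x₁ ^ (ρ ^ J)) ^ 2 := by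
          rw [← Real.rpow_pow_comm hy0, hy, Real.mul_rpow (hu _) (Real.rpow_nonneg (hη _ _) _),
            ← Real.rpow_mul (hη _ _), mul_comm (u x₁ ^ _)]
        rw [e3]
        have hv0 : 0 ≤ u x₁ ^ (ρ ^ J) := Real.rpow_nonneg (hu _) _
        refine pow_le_pow_left₀ (mul_nonneg (Real.rpow_nonneg (hη _ _) _) hv0) ?_ 2
        refine mul_le_mul_of_nonneg_right ?_ hv0
        exact Real.rpow_le_rpow_of_exponent_ge' (hη _ _) (hη1 _ _)
          (by nlinarith [hρj J]) (by linarith)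
      calc _ ≤ piOf d ω x₁ *
            (cutoff d x₀ N J x₁ ^ (b * ρ ^ J - c₀) * u x₁ ^ (ρ ^ J)) ^ 2 :=
            mul_le_mul_of_nonneg_left h8 (hpi _)
        _ ≤ S J * N ^ d := h7
        _ ≤ a * (S 0 / a) ^ (ρ ^ J) * N ^ d := mul_le_mul_of_nonneg_right hSJ (by positivity)
        _ = _ := by ring
    have hfin := le_two_mul_of_mul_rpow_le (hρj J) (div_nonneg hS0' ha.le) hpi1' (sq_nonneg y)
      hpt (by
        have e4 : a * K * (N : ℝ) ^ (2 * d) = a * N ^ d * (K * N ^ d) := by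
          rw [two_mul, pow_add]; ring
        rw [e4] at hJ2
        calc a * (N : ℝ) ^ d ≤ a * N ^ d * (K * N ^ d * piOf d ω x₁) :=
              le_mul_of_one_le_right (by positivity) hpi1
          _ = piOf d ω x₁ * (a * N ^ d * (K * N ^ d)) := by ring
          _ ≤ _ := mul_le_mul_of_nonneg_left hJ2 (hpi _))
    have h4b : ((2 : ℝ) ^ b) ^ 2 = 4 ^ b := by
      rw [Real.rpow_pow_comm zero_le_two]; norm_num
    have hMM : M * M ≤ M * (2 * 4 ^ b / a * A) := by
      calc M * M = M ^ 2 := by ring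
        _ ≤ (2 ^ b * y) ^ 2 := pow_le_pow_left₀ hM0 hMy 2
        _ = 4 ^ b * y ^ 2 := by rw [mul_pow, h4b]
        _ ≤ 4 ^ b * (2 * (M * A / a)) := by
            refine mul_le_mul_of_nonneg_left (hfin.trans ?_) (by positivity)
            gcongr
        _ = _ := by ring
    have hMA : M ≤ 2 * 4 ^ b / a * A := by
      rcases hM0.eq_or_lt with h0 | h0
      · rw [← h0]; positivity
      · exact le_of_mul_le_mul_left hMM h0
    exact hMA.trans (mul_le_mul_of_nonneg_right (le_max_right _ _) hA0)

theorem sum_forward_le_sum_edgesIn {d : ℕ} {g : EdgeIx d → ℝ} (hg : ∀ e, 0 ≤ g e)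
    (Λ : Finset (Vert d)) :
    ∑ x ∈ Λ, ∑ i, g (x, i) ≤ ∑ e ∈ edgesIn d Λ, g e := by
  rw [← Finset.sum_product' Λ Finset.univ (fun x i => g (x, i))]
  refine Finset.sum_le_sum_of_subset_of_nonneg (fun e he => ?_) fun e _ _ => hg e
  simp only [edgesIn, Finset.mem_biUnion, Finset.mem_union, Finset.mem_image, Finset.mem_univ,
    true_and]
  exact ⟨e.1, (Finset.mem_product.1 he).1, Or.inl ⟨e.2, rfl⟩⟩

theorem sum_backward_le_sum_edgesIn {d : ℕ} {g : EdgeIx d → ℝ} (hg : ∀ e, 0 ≤ g e)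
    (Λ : Finset (Vert d)) :
    ∑ x ∈ Λ, ∑ i, g (x - unitv d i, i) ≤ ∑ e ∈ edgesIn d Λ, g e := by
  rw [← Finset.sum_product' Λ Finset.univ (fun x i => g (x - unitv d i, i)),
    ← Finset.sum_image (f := g) (g := fun e : Vert d × Fin d => (e.1 - unitv d e.2, e.2))]
  · refine Finset.sum_le_sum_of_subset_of_nonneg (fun e he => ?_) fun e _ _ => hg e
    simp only [edgesIn, Finset.mem_biUnion, Finset.mem_union, Finset.mem_image, Finset.mem_univ,
      true_and]
    obtain ⟨z, hz, rfl⟩ := Finset.mem_image.1 he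
    exact ⟨z.1, (Finset.mem_product.1 hz).1, Or.inr ⟨z.2, rfl⟩⟩
  · rintro ⟨x, i⟩ _ ⟨y, j⟩ _ h
    obtain ⟨h1, rfl⟩ := Prod.mk.inj h
    exact Prod.ext (sub_left_injective h1) rfl

theorem piOf_rpow_le {d : ℕ} (ω : EnvSp d) {p : ℝ} (hp : 1 ≤ p) (x : Vert d) :
    piOf d ω x ^ p ≤ (2 * d : ℝ) ^ (p - 1) *
      ∑ i, (ω.1 (x, i) ^ p + ω.1 (x - unitv d i, i) ^ p) := by
  have h := Real.rpow_sum_le_const_mul_sum_rpow_of_nonneg (Finset.univ : Finset (Fin d × Bool))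
    (f := fun j => if j.2 then ω.1 (x, j.1) else ω.1 (x - unitv d j.1, j.1)) hp
    (fun j _ => by split_ifs <;> exact (ω.2 _).le)
  simp only [Fintype.sum_prod_type, Fintype.sum_bool, if_true, Bool.false_eq_true, if_false,
    Finset.card_univ, Fintype.card_prod, Fintype.card_fin, Fintype.card_bool] at h
  push_cast at h
  rw [mul_comm (d : ℝ) 2] at h
  exact h

theorem InOmegaPQ.exists_box_bound {d : ℕ} {p q : ℝ} (hp : 1 ≤ p) {ω : EnvSp d}
    (h : InOmegaPQ d p q ω) : ∃ C : ℝ, 0 ≤ C ∧ ∀ n : ℕ, 1 ≤ n →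
      ∑ x ∈ box d (n : ℝ), ∑ i, ω.1 (x, i) ^ (-q) ≤ C * (n : ℝ) ^ d ∧
      ∑ x ∈ box d (n : ℝ), piOf d ω x ^ p ≤ C * (n : ℝ) ^ d := by
  obtain ⟨⟨C₁, h1⟩, C₂, h2⟩ := h
  have hr : ∀ s : ℝ, ∀ e, 0 ≤ ω.1 e ^ s := fun s e => Real.rpow_nonneg (ω.2 e).le _
  refine ⟨max (max C₂ 0) ((2 * d : ℝ) ^ (p - 1) * (2 * C₁)), by simp, fun n hn => ?_⟩
  have hn0 : (0 : ℝ) < n := by exact_mod_cast hn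
  have h1n := h1 n hn
  have h2n := h2 n hn
  rw [div_le_iff₀ (by positivity)] at h1n h2n
  constructor
  · refine (sum_forward_le_sum_edgesIn (hr _) _).trans (h2n.trans ?_)
    gcongr
    exact (le_max_left _ _).trans (le_max_left _ _)
  · calc _ ≤ ∑ x ∈ box d (n : ℝ), (2 * d : ℝ) ^ (p - 1) *
          ∑ i, (ω.1 (x, i) ^ p + ω.1 (x - unitv d i, i) ^ p) :=
          Finset.sum_le_sum fun x _ => piOf_rpow_le ω hp x
      _ = (2 * d : ℝ) ^ (p - 1) * (∑ x ∈ box d (n : ℝ), ∑ i, ω.1 (x, i) ^ p +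
          ∑ x ∈ box d (n : ℝ), ∑ i, ω.1 (x - unitv d i, i) ^ p) := by
          rw [← Finset.mul_sum, ← Finset.sum_add_distrib]
          simp only [Finset.sum_add_distrib]
      _ ≤ (2 * d : ℝ) ^ (p - 1) * (C₁ * n ^ d + C₁ * n ^ d) := by
          gcongr
          · exact (sum_forward_le_sum_edgesIn (hr _) _).trans h1n
          · exact (sum_backward_le_sum_edgesIn (g := fun e => ω.1 e ^ p) (hr _) _).trans h1n
      _ = (2 * d : ℝ) ^ (p - 1) * (2 * C₁) * n ^ d := by ring
      _ ≤ _ := by gcongr; exact le_max_right _ _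

theorem InOmegaPQ.exists_momentBound {d : ℕ} {p q : ℝ} (hp : 1 ≤ p) {ω : EnvSp d}
    (h : InOmegaPQ d p q ω) : ∃ K : ℝ, 1 ≤ K ∧ ∀ (x₀ : Vert d) (N : ℕ), 1 ≤ N →
      supN x₀ ≤ 3 * N → MomentBound d p q K ω N (ball d x₀ N) := by
  obtain ⟨C, hC, hb⟩ := h.exists_box_bound hp
  refine ⟨max 1 (C * 4 ^ d), le_max_left _ _, fun x₀ N hN hx => ?_⟩
  have hsub : ball d x₀ N ⊆ box d ((4 * N : ℕ) : ℝ) := fun x hx' => by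
    rw [mem_box]
    have h1 := supN_add_le (x - x₀) x₀
    rw [sub_add_cancel] at h1
    have h2 := mem_ball.1 hx'
    omega
  have hle : C * ((4 * N : ℕ) : ℝ) ^ d ≤ max 1 (C * 4 ^ d) * (N : ℝ) ^ d := by
    calc _ = C * 4 ^ d * (N : ℝ) ^ d := by push_cast; rw [mul_pow]; ring
      _ ≤ _ := by gcongr; exact le_max_right _ _
  obtain ⟨h1, h2⟩ := hb (4 * N) (by omega)
  refine ⟨le_trans ?_ (h1.trans hle), le_trans ?_ (h2.trans hle)⟩
  · exact Finset.sum_le_sum_of_subset_of_nonneg hsub fun x _ _ =>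
      Finset.sum_nonneg fun i _ => Real.rpow_nonneg (ω.2 _).le _
  · exact Finset.sum_le_sum_of_subset_of_nonneg hsub fun x _ _ =>
      Real.rpow_nonneg (piOf_nonneg ω x) _

theorem card_box {d : ℕ} (n : ℕ) : (box d (n : ℝ)).card = (2 * n + 1) ^ d := by
  have h : ⌈-(n : ℝ)⌉ = -(n : ℤ) := by rw [Int.ceil_neg, Int.floor_natCast]
  simp only [box, h, Int.floor_natCast, Fintype.card_piFinset, Int.card_Icc, Finset.prod_const,
    Finset.card_univ, Fintype.card_fin]
  congr 1
  omega

theorem InOmegaPQ.exists_average_piOf_le {d : ℕ} {p q : ℝ} (hp : 1 ≤ p) {ω : EnvSp d}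
    (h : InOmegaPQ d p q ω) : ∃ C : ℝ, 0 ≤ C ∧ ∀ n : ℕ, 1 ≤ n →
      (∑ x ∈ box d (n : ℝ), piOf d ω x) / ((box d (n : ℝ)).card : ℝ) ≤ C := by
  obtain ⟨C, hC, hb⟩ := h.exists_box_bound hp
  refine ⟨1 + C, by linarith, fun n hn => ?_⟩
  have hc : (n : ℝ) ^ d ≤ ((box d (n : ℝ)).card : ℝ) := by
    rw [card_box]
    exact_mod_cast Nat.pow_le_pow_left (by omega) d
  have hn0 : (0 : ℝ) < n := by exact_mod_cast hn
  rw [div_le_iff₀ (lt_of_lt_of_le (by positivity) hc)]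
  calc ∑ x ∈ box d (n : ℝ), piOf d ω x ≤ ∑ x ∈ box d (n : ℝ), (1 + piOf d ω x ^ p) := by
        refine Finset.sum_le_sum fun x _ => ?_
        have h0 := Real.rpow_nonneg (piOf_nonneg ω x) p
        rcases le_total (piOf d ω x) 1 with h1 | h1
        · linarith
        · have := Real.rpow_le_rpow_of_exponent_le h1 hp
          rw [Real.rpow_one] at this
          linarith
    _ = (box d (n : ℝ)).card + ∑ x ∈ box d (n : ℝ), piOf d ω x ^ p := by
        rw [Finset.sum_add_distrib]; simp
    _ ≤ (box d (n : ℝ)).card + C * (box d (n : ℝ)).card := by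
        gcongr
        exact (hb n hn).2.trans (by gcongr)
    _ = _ := by ring

/-- The heat kernel `P_ω^0(X_n = x) / π_ω(x)` of the discrete-time walk. -/
def heat (d : ℕ) (ω : EnvSp d) : ℕ → Vert d → ℝ
  | 0, x => if x = 0 then 1 / piOf d ω 0 else 0
  | n+1, x => (∑ i, (ω.1 (x, i) * heat d ω n (x + unitv d i) +
      ω.1 (x - unitv d i, i) * heat d ω n (x - unitv d i))) / piOf d ω x

theorem heat_nonneg {d : ℕ} (ω : EnvSp d) (n : ℕ) (x : Vert d) : 0 ≤ heat d ω n x := by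
  induction n generalizing x with
  | zero => unfold heat; split_ifs; exacts [div_nonneg zero_le_one (piOf_nonneg ω 0), le_rfl]
  | succ n ih =>
    exact div_nonneg (Finset.sum_nonneg fun i _ => add_nonneg (mul_nonneg (ω.2 _).le (ih _))
      (mul_nonneg (ω.2 _).le (ih _))) (piOf_nonneg ω x)

theorem supN_le_of_heat_ne_zero {d : ℕ} {ω : EnvSp d} {n : ℕ} {x : Vert d}
    (h : heat d ω n x ≠ 0) : supN x ≤ n := by
  induction n generalizing x with
  | zero =>
    by_contra hc
    refine h ?_
    have : x ≠ 0 := fun h0 => hc (by rw [h0, supN_zero])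
    simp [heat, this]
  | succ n ih =>
    by_contra hc
    refine h ?_
    rw [heat, Finset.sum_eq_zero, zero_div]
    intro i _
    have h1 : heat d ω n (x + unitv d i) = 0 := by
      by_contra h0
      have := ih h0
      have := supN_le_add_unitv x i
      omega
    have h2 : heat d ω n (x - unitv d i) = 0 := by
      by_contra h0
      have := ih h0
      have := supN_le_add_unitv (x - unitv d i) i
      have := supN_add_unitv_le (x - unitv d i) i
      rw [sub_add_cancel] at this
      omega
    simp [h1, h2]

theorem measure_eq_tsum_preimage_inter {α β : Type*} [MeasurableSpace α] [MeasurableSpace β]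
    [Countable β] [MeasurableSingletonClass β] (μ : Measure α) {g : α → β} (hg : Measurable g)
    {A : Set α} (hA : MeasurableSet A) : μ A = ∑' b, μ (g ⁻¹' {b} ∩ A) := by
  rw [← measure_iUnion]
  · congr 1
    ext a
    simp
  · intro b c hbc
    refine Set.disjoint_left.2 fun a ha ha' => hbc ?_
    exact ha.1.symm.trans ha'.1
  · exact fun b => (hg (measurableSet_singleton b)).inter hA

theorem measurableSet_eval_eq {d : ℕ} (n : ℕ) (x : Vert d) :
    MeasurableSet {w : Path d | w n = x} :=
  (measurable_pi_apply (X := fun _ : ℕ => Vert d) n) (measurableSet_singleton x)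

theorem IsWalkLaw.measure_eval_inter_eval_succ {d : ℕ} {ω : EnvSp d} {μ : Measure (Path d)}
    {x₀ : Vert d} (hμ : IsWalkLaw d ω x₀ μ) (n : ℕ) (x y : Vert d) :
    μ ({w | w n = x} ∩ {w | w (n + 1) = y}) =
      μ {w | w n = x} * ENNReal.ofReal (transP d ω x y) := by
  let g : Path d → (Fin (n + 1) → Vert d) := fun w k => w k
  have hg : Measurable g := measurable_pi_lambda _ fun k => measurable_pi_apply _
  rw [measure_eq_tsum_preimage_inter μ hg
      ((measurableSet_eval_eq n x).inter (measurableSet_eval_eq (n + 1) y)),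
    measure_eq_tsum_preimage_inter μ hg (measurableSet_eval_eq n x), ← ENNReal.tsum_mul_right]
  refine tsum_congr fun t => ?_
  by_cases ht : t (Fin.last n) = x
  · let γ : ℕ → Vert d := fun k => if h : k < n + 1 then t ⟨k, h⟩ else y
    have hγn : γ n = x := by simp [γ, ← ht, Fin.last]
    have hγs : γ (n + 1) = y := by simp [γ]
    have hgt : ∀ w : Path d, g w = t ↔ ∀ k ≤ n, w k = γ k := fun w => by
      constructor
      · intro h k hk
        have := congrFun h ⟨k, Nat.lt_succ_of_le hk⟩
        simpa only [g, γ, dif_pos (Nat.lt_succ_of_le hk)] using this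
      · intro h
        funext k
        have := h k (Nat.le_of_lt_succ k.2)
        simpa only [g, γ, dif_pos k.2] using this
    have e1 : g ⁻¹' {t} ∩ ({w | w n = x} ∩ {w | w (n + 1) = y}) =
        {w | ∀ k ≤ n + 1, w k = γ k} := by
      ext w
      simp only [Set.mem_inter_iff, Set.mem_preimage, Set.mem_singleton_iff, Set.mem_ofPred_eq, hgt]
      constructor
      · rintro ⟨h1, -, h2⟩ k hk
        rcases Nat.le_succ_iff.1 hk with h | h
        · exact h1 k h
        · rw [h]; exact h2.trans hγs.symm
      · intro h
        exact ⟨fun k hk => h k (by omega), (h n (by omega)).trans hγn, (h _ le_rfl).trans hγs⟩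
    have e2 : g ⁻¹' {t} ∩ {w | w n = x} = {w | ∀ k ≤ n, w k = γ k} := by
      ext w
      simp only [Set.mem_inter_iff, Set.mem_preimage, Set.mem_singleton_iff, Set.mem_ofPred_eq, hgt]
      exact ⟨fun h => h.1, fun h => ⟨h, (h n le_rfl).trans hγn⟩⟩
    rw [e1, e2, hμ.2, hμ.2, Finset.prod_range_succ, hγn, hγs, mul_assoc]
  · have e : g ⁻¹' {t} ∩ {w | w n = x} = ∅ := by
      ext w
      simp only [Set.mem_inter_iff, Set.mem_preimage, Set.mem_singleton_iff, Set.mem_ofPred_eq,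
        Set.mem_empty_iff_false, iff_false]
      rintro ⟨rfl, h⟩
      exact ht h
    rw [← Set.inter_assoc, e]
    simp

theorem IsWalkLaw.measure_eval {d : ℕ} (hd : 1 ≤ d) {ω : EnvSp d} {μ : Measure (Path d)}
    (hμ : IsWalkLaw d ω 0 μ) (n : ℕ) (x : Vert d) :
    μ {w | w n = x} = ENNReal.ofReal (piOf d ω x * heat d ω n x) := by
  induction n generalizing x with
  | zero =>
    have h := hμ.2 0 (fun _ => x)
    simp only [Nat.le_zero, forall_eq, Finset.range_zero, Finset.prod_empty, mul_one] at h
    rw [h, heat]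
    split_ifs with h0
    · rw [h0, mul_one_div_cancel (piOf_pos hd ω 0).ne', ENNReal.ofReal_one]
    · simp
  | succ n ih =>
    rw [measure_eq_tsum_preimage_inter μ (measurable_pi_apply n) (measurableSet_eval_eq (n + 1) x)]
    have e : ∀ z, μ ((fun w : Path d => w n) ⁻¹' {z} ∩ {w | w (n + 1) = x}) =
        ∑ i, ((if z = x - unitv d i then
            ENNReal.ofReal (ω.1 (x - unitv d i, i) * heat d ω n (x - unitv d i)) else 0) +
          if z = x + unitv d i then ENNReal.ofReal (ω.1 (x, i) * heat d ω n (x + unitv d i))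
            else 0) := fun z => by
      have h1 := hμ.measure_eval_inter_eval_succ n z x
      have h2 : piOf d ω z * heat d ω n z * transP d ω z x = cnd d ω z x * heat d ω n z := by
        rw [transP]
        have := (piOf_pos hd ω z).ne'
        field_simp
      refine h1.trans ?_
      rw [ih z, ← ENNReal.ofReal_mul (mul_nonneg (piOf_nonneg ω z) (heat_nonneg ω n z)), h2, cnd,
        Finset.sum_mul, ENNReal.ofReal_sum_of_nonneg]
      · refine Finset.sum_congr rfl fun i _ => ?_
        rw [add_mul, ENNReal.ofReal_add]
        · congr 1
          · by_cases h3 : x = z + unitv d i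
            · rw [if_pos h3, if_pos (eq_sub_of_add_eq h3.symm), h3, add_sub_cancel_right]
            · rw [if_neg h3, if_neg fun h4 => h3 (by rw [h4, sub_add_cancel])]; simp
          · by_cases h3 : z = x + unitv d i
            · rw [if_pos h3, if_pos h3, h3]
            · rw [if_neg h3, if_neg h3]; simp
        · exact mul_nonneg (by split_ifs; exacts [(ω.2 _).le, le_rfl]) (heat_nonneg ω n z)
        · exact mul_nonneg (by split_ifs; exacts [(ω.2 _).le, le_rfl]) (heat_nonneg ω n z)
      · exact fun i _ => mul_nonneg (add_nonneg (by split_ifs; exacts [(ω.2 _).le, le_rfl])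
          (by split_ifs; exacts [(ω.2 _).le, le_rfl])) (heat_nonneg ω n z)
    rw [tsum_congr e, Summable.tsum_finsetSum fun i _ => ENNReal.summable, heat,
      mul_div_cancel₀ _ (piOf_pos hd ω x).ne', ENNReal.ofReal_sum_of_nonneg]
    · refine Finset.sum_congr rfl fun i _ => ?_
      rw [ENNReal.tsum_add, tsum_ite_eq, tsum_ite_eq, ENNReal.ofReal_add, add_comm]
      · exact mul_nonneg (ω.2 _).le (heat_nonneg ω n _)
      · exact mul_nonneg (ω.2 _).le (heat_nonneg ω n _)
    · exact fun i _ => add_nonneg (mul_nonneg (ω.2 _).le (heat_nonneg ω n _))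
        (mul_nonneg (ω.2 _).le (heat_nonneg ω n _))

theorem IsWalkLaw.sum_heat_le_one {d : ℕ} (hd : 1 ≤ d) {ω : EnvSp d} {μ : Measure (Path d)}
    (hμ : IsWalkLaw d ω 0 μ) (n : ℕ) (Q : Finset (Vert d)) :
    ∑ x ∈ Q, piOf d ω x * heat d ω n x ≤ 1 := by
  have := hμ.1
  have h0 : ∀ x, 0 ≤ piOf d ω x * heat d ω n x := fun x =>
    mul_nonneg (piOf_nonneg ω x) (heat_nonneg ω n x)
  rw [← ENNReal.ofReal_le_ofReal_iff zero_le_one, ENNReal.ofReal_sum_of_nonneg fun x _ => h0 x,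
    ENNReal.ofReal_one]
  calc _ = ∑ x ∈ Q, μ ((fun w : Path d => w n) ⁻¹' {x}) :=
        Finset.sum_congr rfl fun x _ => (hμ.measure_eval hd n x).symm
    _ = μ ((fun w : Path d => w n) ⁻¹' Q) :=
        sum_measure_preimage_singleton Q fun x _ => measurableSet_eval_eq n x
    _ ≤ 1 := prob_le_one

theorem IsWalkLaw.integral_eval {d : ℕ} (hd : 1 ≤ d) {ω : EnvSp d} {μ : Measure (Path d)}
    (hμ : IsWalkLaw d ω 0 μ) (f : Vert d → ℝ) {n : ℕ} {Q : Finset (Vert d)}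
    (hQ : ∀ x, supN x ≤ n → x ∈ Q) :
    ∫ w, f (w n) ∂μ = ∑ x ∈ Q, f x * (piOf d ω x * heat d ω n x) := by
  have := hμ.1
  have h1 : ∀ᵐ w ∂μ, ∀ x, x ∉ Q → w n ≠ x := by
    rw [ae_all_iff]
    intro x
    by_cases hx : x ∈ Q
    · exact ae_of_all _ fun w h => absurd hx h
    · have h0 : heat d ω n x = 0 := by
        by_contra hc
        exact hx (hQ x (supN_le_of_heat_ne_zero hc))
      have hm := hμ.measure_eval hd n x
      rw [h0, mul_zero, ENNReal.ofReal_zero] at hm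
      have : ∀ᵐ w ∂μ, w n ≠ x := by
        rw [ae_iff]
        simpa using hm
      filter_upwards [this] with w hw _ using hw
  have h2 : ∫ w, f (w n) ∂μ = ∫ w, ∑ x ∈ Q, ({w | w n = x} : Set (Path d)).indicator
      (fun _ => f x) w ∂μ := by
    refine integral_congr_ae ?_
    filter_upwards [h1] with w hw
    have hwQ : w n ∈ Q := by
      by_contra hc
      exact hw _ hc rfl
    rw [Finset.sum_eq_single (w n)]
    · simp
    · intro x _ hx
      simp [Set.indicator, hx.symm]
    · exact fun h => absurd hwQ h
  rw [h2, integral_finsetSum]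
  · refine Finset.sum_congr rfl fun x _ => ?_
    rw [integral_indicator_const _ (measurableSet_eval_eq n x), Measure.real,
      hμ.measure_eval hd n x, ENNReal.toReal_ofReal
      (mul_nonneg (piOf_nonneg ω x) (heat_nonneg ω n x)), smul_eq_mul, mul_comm]
  · exact fun x _ => (integrable_const _).indicator (measurableSet_eval_eq n x)

/-- The time average of the heat kernel over the first `n` steps. -/
def avgHeat (d : ℕ) (ω : EnvSp d) (n : ℕ) (x : Vert d) : ℝ :=
  (∑ k ∈ Finset.range n, heat d ω k x) / n

theorem avgHeat_nonneg {d : ℕ} (ω : EnvSp d) (n : ℕ) (x : Vert d) : 0 ≤ avgHeat d ω n x :=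
  div_nonneg (Finset.sum_nonneg fun k _ => heat_nonneg ω k x) (Nat.cast_nonneg _)

theorem supN_le_of_avgHeat_ne_zero {d : ℕ} {ω : EnvSp d} {n : ℕ} {x : Vert d}
    (h : avgHeat d ω n x ≠ 0) : supN x ≤ n := by
  by_contra hc
  refine h ?_
  rw [avgHeat, Finset.sum_eq_zero, zero_div]
  intro k hk
  by_contra h0
  have := supN_le_of_heat_ne_zero h0
  have := Finset.mem_range.1 hk
  omega

theorem avgHeat_generator {d : ℕ} (hd : 1 ≤ d) (ω : EnvSp d) (n : ℕ) (x : Vert d) :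
    piOf d ω x * avgHeat d ω n x - ∑ i, (ω.1 (x, i) * avgHeat d ω n (x + unitv d i) +
      ω.1 (x - unitv d i, i) * avgHeat d ω n (x - unitv d i)) =
      piOf d ω x * (heat d ω 0 x - heat d ω n x) / n := by
  have h1 : ∀ k, ∑ i, (ω.1 (x, i) * heat d ω k (x + unitv d i) +
      ω.1 (x - unitv d i, i) * heat d ω k (x - unitv d i)) = piOf d ω x * heat d ω (k + 1) x :=
    fun k => by rw [heat, mul_div_cancel₀ _ (piOf_pos hd ω x).ne']
  have h2 : ∑ i, (ω.1 (x, i) * avgHeat d ω n (x + unitv d i) +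
      ω.1 (x - unitv d i, i) * avgHeat d ω n (x - unitv d i)) =
      (∑ k ∈ Finset.range n, piOf d ω x * heat d ω (k + 1) x) / n := by
    simp only [← h1]
    rw [Finset.sum_comm, Finset.sum_div]
    refine Finset.sum_congr rfl fun i _ => ?_
    rw [Finset.sum_add_distrib, ← Finset.mul_sum, ← Finset.mul_sum]
    simp only [avgHeat]
    ring
  rw [h2, avgHeat, ← mul_div_assoc, ← sub_div, Finset.mul_sum, ← Finset.sum_sub_distrib]
  simp only [← mul_sub]
  rw [← Finset.mul_sum, Finset.sum_range_sub']

theorem subharmonicAt_avgHeat {d : ℕ} (hd : 1 ≤ d) (ω : EnvSp d) (n : ℕ) {x : Vert d}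
    (hx : x ≠ 0) : SubharmonicAt d ω (avgHeat d ω n) x := by
  have h := avgHeat_generator hd ω n x
  have h0 : heat d ω 0 x = 0 := by simp [heat, hx]
  rw [h0, zero_sub, mul_neg, neg_div] at h
  have : 0 ≤ piOf d ω x * heat d ω n x / n :=
    div_nonneg (mul_nonneg (piOf_nonneg ω x) (heat_nonneg ω n x)) (Nat.cast_nonneg _)
  unfold SubharmonicAt
  linarith

theorem IsWalkLaw.sum_avgHeat_le_one {d : ℕ} (hd : 1 ≤ d) {ω : EnvSp d} {μ : Measure (Path d)}
    (hμ : IsWalkLaw d ω 0 μ) (n : ℕ) (Q : Finset (Vert d)) :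
    ∑ x ∈ Q, piOf d ω x * avgHeat d ω n x ≤ 1 := by
  have h : ∑ x ∈ Q, piOf d ω x * avgHeat d ω n x =
      (∑ k ∈ Finset.range n, ∑ x ∈ Q, piOf d ω x * heat d ω k x) / n := by
    rw [Finset.sum_comm, Finset.sum_div]
    refine Finset.sum_congr rfl fun x _ => ?_
    rw [avgHeat, ← Finset.mul_sum, mul_div_assoc]
  rw [h]
  refine div_le_one_of_le₀ ?_ (Nat.cast_nonneg _)
  calc _ ≤ ∑ k ∈ Finset.range n, (1 : ℝ) :=
        Finset.sum_le_sum fun k _ => hμ.sum_heat_le_one hd k Q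
    _ = n := by simp

theorem IsWalkLaw.gradient_avgHeat_le {d : ℕ} (hd : 1 ≤ d) {ω : EnvSp d} {μ : Measure (Path d)}
    (hμ : IsWalkLaw d ω 0 μ) (n : ℕ) (x : Vert d) (i : Fin d) :
    ω.1 (x, i) * (avgHeat d ω n (x + unitv d i) - avgHeat d ω n x) ^ 2 ≤
      (piOf d ω 0)⁻¹ / n := by
  set U := avgHeat d ω n with hU
  set Q := ball d 0 (n + 1 + supN x) with hQ
  have hpi0 := piOf_pos hd ω 0
  have hxQ : x ∈ Q := mem_ball.2 (by rw [sub_zero]; omega)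
  have h := sum_sum_mul_sub_mul_sub ω (Q := Q) (v := U) (φ := U) fun y hy =>
    ball_of_supN_lt (by
      have := supN_le_of_avgHeat_ne_zero hy
      rw [sub_zero]; omega)
  have hpos : ∀ y j, 0 ≤ ω.1 (y, j) *
      ((U (y + unitv d j) - U y) * (U (y + unitv d j) - U y)) := fun y j =>
    mul_nonneg (ω.2 _).le (mul_self_nonneg _)
  have h1 : ω.1 (x, i) * (U (x + unitv d i) - U x) ^ 2 ≤ ∑ y ∈ Q, ∑ j, ω.1 (y, j) *
      ((U (y + unitv d j) - U y) * (U (y + unitv d j) - U y)) := by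
    rw [pow_two]
    exact (Finset.single_le_sum (f := fun j => ω.1 (x, j) *
      ((U (x + unitv d j) - U x) * (U (x + unitv d j) - U x))) (fun j _ => hpos x j)
      (Finset.mem_univ i)).trans (Finset.single_le_sum (f := fun y => ∑ j, ω.1 (y, j) *
      ((U (y + unitv d j) - U y) * (U (y + unitv d j) - U y)))
      (fun y _ => Finset.sum_nonneg fun j _ => hpos y j) hxQ)
  refine h1.trans (h.le.trans ?_)
  have h2 : ∀ y ∈ Q, U y * (piOf d ω y * U y - ∑ i, (ω.1 (y, i) * U (y + unitv d i) +
      ω.1 (y - unitv d i, i) * U (y - unitv d i))) ≤ if y = 0 then U 0 / n else 0 := by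
    intro y _
    rw [hU, avgHeat_generator hd ω n y, ← hU]
    have hy : 0 ≤ U y * (piOf d ω y * heat d ω n y / n) :=
      mul_nonneg (avgHeat_nonneg ω n y) (div_nonneg (mul_nonneg (piOf_nonneg ω y)
        (heat_nonneg ω n y)) (Nat.cast_nonneg _))
    split_ifs with h0
    · subst h0
      have e : piOf d ω 0 * heat d ω 0 0 = 1 := by simp [heat, hpi0.ne']
      rw [mul_sub, e, sub_div, mul_sub, mul_one_div]
      linarith
    · have e : heat d ω 0 y = 0 := by simp [heat, h0]
      rw [e, zero_sub, mul_neg, neg_div, mul_neg]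
      linarith
  refine (Finset.sum_le_sum h2).trans ?_
  rw [Finset.sum_ite_eq' Q 0, if_pos (mem_ball.2 (by simp [supN_zero]))]
  gcongr
  have h3 := hμ.sum_avgHeat_le_one hd n {0}
  rw [Finset.sum_singleton] at h3
  rw [← one_div, le_div_iff₀ hpi0, mul_comm]
  exact h3

theorem IsWalkLaw.tendsto_avgHeat_sub {d : ℕ} (hd : 1 ≤ d) {ω : EnvSp d} {μ : Measure (Path d)}
    (hμ : IsWalkLaw d ω 0 μ) (x y : Vert d) :
    Tendsto (fun n => avgHeat d ω n (x + y) - avgHeat d ω n x) atTop (𝓝 0) := by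
  let H : AddSubgroup (Vert d) :=
    { carrier := {y | ∀ x, Tendsto (fun n => avgHeat d ω n (x + y) - avgHeat d ω n x) atTop (𝓝 0)}
      zero_mem' := fun x => by simp
      add_mem' := fun {y z} hy hz x => by
        have := (hz (x + y)).add (hy x)
        simpa [add_assoc] using this
      neg_mem' := fun {y} hy x => by
        have := (hy (x + -y)).neg
        simpa using this }
  have hunit : ∀ i, unitv d i ∈ H := fun i x => by
    have hω := ω.2 (x, i)
    refine squeeze_zero_norm (a := fun n : ℕ => Real.sqrt ((ω.1 (x, i))⁻¹ *
      ((piOf d ω 0)⁻¹ / n))) (fun n => ?_) ?_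
    · rw [Real.norm_eq_abs]
      refine Real.abs_le_sqrt ?_
      rw [le_inv_mul_iff₀ hω]
      exact hμ.gradient_avgHeat_le hd n x i
    · have h1 : Tendsto (fun n : ℕ => (ω.1 (x, i))⁻¹ * ((piOf d ω 0)⁻¹ / n)) atTop (𝓝 0) := by
        simpa using (tendsto_const_div_atTop_nhds_zero_nat ((piOf d ω 0)⁻¹)).const_mul
          ((ω.1 (x, i))⁻¹)
      have h2 := (Real.continuous_sqrt.tendsto 0).comp h1
      rw [Real.sqrt_zero] at h2
      exact h2
  have hy : y = ∑ i, y i • unitv d i := by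
    funext j
    simp [Finset.sum_apply, unitv]
  have hyH : y ∈ H := by
    rw [hy]
    exact H.sum_mem fun i _ => H.zsmul_mem (hunit i) _
  exact hyH x

theorem exists_avgHeat_le {d : ℕ} (hd : 1 ≤ d) {p q : ℝ} (hp : 1 < p) (hq : 1 < q)
    (hpq : 2 ≤ d → 1 / p + 1 / q < 2 / (d : ℝ)) {ω : EnvSp d} (hmom : InOmegaPQ d p q ω) :
    ∃ (C : ℝ) (N₀ : ℕ), 0 < C ∧ 0 < N₀ ∧ ∀ (n N : ℕ) (x : Vert d), N₀ ≤ N → N ≤ supN x →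
      supN x ≤ 3 * N → avgHeat d ω n x ≤
        C * ((∑ y ∈ ball d x N, piOf d ω y * avgHeat d ω n y) / (N : ℝ) ^ d) := by
  obtain ⟨K, hK, hKb⟩ := hmom.exists_momentBound hp.le
  obtain ⟨C, N₀, hC, hN₀, h⟩ := exists_mean_value_le hd hp hq hpq hK
  refine ⟨C, N₀, hC, hN₀, fun n N x hN h1 h2 => h ω x N _ hN (hKb x N (by omega) h2)
    (avgHeat_nonneg ω n) fun y hy => subharmonicAt_avgHeat hd ω n ?_⟩
  rintro rfl
  rw [zero_sub, supN_neg] at hy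
  omega

theorem IsWalkLaw.tendsto_avgHeat {d : ℕ} (hd : 1 ≤ d) {p q : ℝ} (hp : 1 < p) (hq : 1 < q)
    (hpq : 2 ≤ d → 1 / p + 1 / q < 2 / (d : ℝ)) {ω : EnvSp d} (hmom : InOmegaPQ d p q ω)
    {μ : Measure (Path d)} (hμ : IsWalkLaw d ω 0 μ) (x : Vert d) :
    Tendsto (fun n => avgHeat d ω n x) atTop (𝓝 0) := by
  obtain ⟨C, N₀, hC, hN₀, h⟩ := exists_avgHeat_le hd hp hq hpq hmom
  rw [Metric.tendsto_atTop']
  intro ε hε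
  obtain ⟨N, hN⟩ := ((tendsto_const_div_atTop_nhds_zero_nat C).eventually_lt_const
    (half_pos hε)).and (eventually_ge_atTop N₀) |>.exists
  let y : Vert d := fun _ => N
  have hy : supN y = N := by
    refine le_antisymm (supN_le_iff.2 fun i => by simp [y]) ?_
    simpa [y] using natAbs_le_supN y ⟨0, hd⟩
  have hN1 : (1 : ℝ) ≤ N := by exact_mod_cast (by omega : 1 ≤ N)
  have hyb : ∀ n, avgHeat d ω n y ≤ C / N := fun n => by
    refine (h n N y hN.2 hy.ge (by omega)).trans ?_
    rw [div_eq_mul_inv C]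
    refine mul_le_mul_of_nonneg_left ?_ hC.le
    rw [← one_div]
    refine div_le_div₀ zero_le_one (hμ.sum_avgHeat_le_one hd n _) (by linarith) ?_
    exact le_self_pow₀ hN1 (by omega)
  have hd := hμ.tendsto_avgHeat_sub hd x (y - x)
  obtain ⟨n₀, hn₀⟩ := Metric.tendsto_atTop'.1 hd (ε / 2) (half_pos hε)
  refine ⟨n₀, fun n hn => ?_⟩
  have h1 := hn₀ n hn
  rw [Real.dist_eq, sub_zero, add_sub_cancel, abs_lt] at h1
  rw [Real.dist_eq, sub_zero, abs_of_nonneg (avgHeat_nonneg ω n x)]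
  linarith [hyb n, hN.1]

theorem sum_mul_local_average_le {d : ℕ} {g h : Vert d → ℝ} (hg : ∀ x, 0 ≤ g x)
    (hh : ∀ x, 0 ≤ h x) {r : ℕ} (hr : 1 ≤ r) {L : ℝ} (hL : 0 ≤ L)
    (hgL : ∀ m : ℕ, r ≤ m → ∑ x ∈ box d (m : ℝ), g x ≤ L * (2 * m + 1) ^ d)
    {W Y : Finset (Vert d)} (hW : ∀ x ∈ W, 2 * r ≤ supN x)
    (hWY : ∀ x ∈ W, ball d x (supN x / 2) ⊆ Y) (hY : ∑ y ∈ Y, h y ≤ 1) :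
    ∑ x ∈ W, g x * ((∑ y ∈ ball d x (supN x / 2), h y) / ((supN x / 2 : ℕ) : ℝ) ^ d) ≤
      20 ^ d * L := by
  classical
  have key : ∀ y, ∑ x ∈ W, (if y ∈ ball d x (supN x / 2) then
      g x / ((supN x / 2 : ℕ) : ℝ) ^ d else 0) ≤ 20 ^ d * L := fun y => by
    rw [← Finset.sum_filter]
    set V := W.filter fun x => y ∈ ball d x (supN x / 2)
    have hV : ∀ x ∈ V, r ≤ supN x / 2 ∧ supN y ≤ 4 * (supN x / 2) ∧ supN x ≤ 2 * supN y ∧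
        r ≤ supN y := fun x hx => by
      obtain ⟨hxW, hxy⟩ := Finset.mem_filter.1 hx
      have h1 := hW x hxW
      have h2 := mem_ball.1 hxy
      have h3 := supN_add_le (y - x) x
      have h4 := supN_sub_le y (y - x)
      rw [sub_add_cancel] at h3
      rw [sub_sub_cancel] at h4
      omega
    rcases V.eq_empty_or_nonempty with hVe | ⟨x', hx'⟩
    · rw [hVe, Finset.sum_empty]; positivity
    have hy := (hV x' hx').2.2.2
    have hy0 : (1 : ℝ) ≤ supN y := by exact_mod_cast hr.trans hy
    calc ∑ x ∈ V, g x / ((supN x / 2 : ℕ) : ℝ) ^ d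
        ≤ ∑ x ∈ V, g x * (4 ^ d / (supN y : ℝ) ^ d) := by
          refine Finset.sum_le_sum fun x hx => ?_
          obtain ⟨h1, h2, -, -⟩ := hV x hx
          have h1' : (0 : ℝ) < ((supN x / 2 : ℕ) : ℝ) := by exact_mod_cast (by omega)
          have h2' : (supN y : ℝ) ≤ 4 * ((supN x / 2 : ℕ) : ℝ) := by exact_mod_cast h2
          rw [div_eq_mul_one_div]
          refine mul_le_mul_of_nonneg_left ?_ (hg x)
          rw [div_le_div_iff₀ (by positivity) (by positivity), one_mul, ← mul_pow]
          gcongr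
      _ = (∑ x ∈ V, g x) * (4 ^ d / (supN y : ℝ) ^ d) := (Finset.sum_mul _ _ _).symm
      _ ≤ (L * (5 * supN y) ^ d) * (4 ^ d / (supN y : ℝ) ^ d) := by
          refine mul_le_mul_of_nonneg_right ?_ (by positivity)
          have hsub : V ⊆ box d ((2 * supN y : ℕ) : ℝ) := fun x hx =>
            mem_box.2 (hV x hx).2.2.1
          refine (Finset.sum_le_sum_of_subset_of_nonneg hsub fun x _ _ => hg x).trans
            ((hgL _ (by omega)).trans ?_)
          refine mul_le_mul_of_nonneg_left (pow_le_pow_left₀ (by positivity) ?_ d) hL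
          push_cast
          linarith
      _ = 20 ^ d * L := by
          rw [show (20 : ℝ) = 5 * 4 by norm_num, mul_pow, mul_pow]
          field_simp
  calc ∑ x ∈ W, g x * ((∑ y ∈ ball d x (supN x / 2), h y) / ((supN x / 2 : ℕ) : ℝ) ^ d)
      = ∑ x ∈ W, ∑ y ∈ Y, (if y ∈ ball d x (supN x / 2) then
          g x / ((supN x / 2 : ℕ) : ℝ) ^ d else 0) * h y := by
        refine Finset.sum_congr rfl fun x hx => ?_
        simp only [ite_mul, zero_mul]
        rw [← Finset.sum_filter, Finset.filter_mem_eq_inter,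
          Finset.inter_eq_right.2 (hWY x hx), ← Finset.mul_sum]
        ring
    _ = ∑ y ∈ Y, (∑ x ∈ W, (if y ∈ ball d x (supN x / 2) then
          g x / ((supN x / 2 : ℕ) : ℝ) ^ d else 0)) * h y := by
        rw [Finset.sum_comm]
        simp only [Finset.sum_mul]
    _ ≤ ∑ y ∈ Y, 20 ^ d * L * h y :=
        Finset.sum_le_sum fun y _ => mul_le_mul_of_nonneg_right (key y) (hh y)
    _ = 20 ^ d * L * ∑ y ∈ Y, h y := (Finset.mul_sum _ _ _).symm
    _ ≤ _ := mul_le_of_le_one_right (by positivity) hY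

theorem IsWalkLaw.average_integral_eq {d : ℕ} (hd : 1 ≤ d) {ω : EnvSp d} {μ : Measure (Path d)}
    (hμ : IsWalkLaw d ω 0 μ) (f : Vert d → ℝ) (n : ℕ) :
    (∑ k ∈ Finset.range n, ∫ w, f (w k) ∂μ) / (n : ℝ) =
      ∑ x ∈ box d (n : ℝ), f x * piOf d ω x * avgHeat d ω n x := by
  have h : ∀ k ∈ Finset.range n, ∫ w, f (w k) ∂μ =
      ∑ x ∈ box d (n : ℝ), f x * (piOf d ω x * heat d ω k x) := fun k hk =>
    hμ.integral_eval hd f fun x hx => mem_box.2 (hx.trans (Finset.mem_range.1 hk).le)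
  rw [Finset.sum_congr rfl h, Finset.sum_comm, Finset.sum_div]
  refine Finset.sum_congr rfl fun x _ => ?_
  rw [← Finset.mul_sum, ← Finset.mul_sum, avgHeat]
  ring

/-- STATEMENT 5 (Conversion lemma, Lemma 3.3). -/
theorem statement5 (d : ℕ) (hd : 1 ≤ d) (p q : ℝ) (hp : 1 < p) (hq : 1 < q)
    (hpq : 2 ≤ d → 1 / p + 1 / q < 2 / (d : ℝ))
    (ω : EnvSp d) (hmom : InOmegaPQ d p q ω)
    (μ : Measure (Path d)) (hμ : IsWalkLaw d ω 0 μ) :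
    ∃ c : ℝ, 0 < c ∧
      ∀ f : Vert d → ℝ, (∀ x, 0 ≤ f x) → (∃ M, ∀ x, f x ≤ M) →
        limsup (fun n : ℕ =>
            (∑ k ∈ Finset.range n, ∫ w, f (w k) ∂μ) / (n : ℝ)) atTop ≤
          c * limsup (fun n : ℕ =>
            (∑ x ∈ box d (n : ℝ), f x * piOf d ω x) / ((box d (n : ℝ)).card : ℝ)) atTop := by
  obtain ⟨C, N₀, hC, hN₀, hmean⟩ := exists_avgHeat_le hd hp hq hpq hmom
  obtain ⟨D, hD, havg⟩ := hmom.exists_average_piOf_le hp.le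
  refine ⟨C * 20 ^ d, by positivity, fun f hf ⟨M, hM⟩ => ?_⟩
  simp only [hμ.average_integral_eq hd f]
  set A : ℕ → ℝ := fun n =>
    (∑ x ∈ box d (n : ℝ), f x * piOf d ω x) / ((box d (n : ℝ)).card : ℝ) with hA
  have hg : ∀ x, 0 ≤ f x * piOf d ω x := fun x => mul_nonneg (hf x) (piOf_nonneg ω x)
  have hM0 : 0 ≤ M := (hf 0).trans (hM 0)
  have hA0 : ∀ n, 0 ≤ A n := fun n =>
    div_nonneg (Finset.sum_nonneg fun x _ => hg x) (Nat.cast_nonneg _)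
  have hAb : IsBoundedUnder (· ≤ ·) atTop A := by
    refine isBoundedUnder_of_eventually_le (a := M * D) ?_
    filter_upwards [eventually_ge_atTop 1] with n hn
    calc A n ≤ (∑ x ∈ box d (n : ℝ), M * piOf d ω x) / ((box d (n : ℝ)).card : ℝ) := by
          refine div_le_div_of_nonneg_right (Finset.sum_le_sum fun x _ => ?_)
            (Nat.cast_nonneg _)
          exact mul_le_mul_of_nonneg_right (hM x) (piOf_nonneg ω x)
      _ = M * ((∑ x ∈ box d (n : ℝ), piOf d ω x) / ((box d (n : ℝ)).card : ℝ)) := by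
          rw [← Finset.mul_sum, mul_div_assoc]
      _ ≤ M * D := mul_le_mul_of_nonneg_left (havg n hn) hM0
  have hbound : ∀ ε > 0, limsup (fun n : ℕ =>
      ∑ x ∈ box d (n : ℝ), f x * piOf d ω x * avgHeat d ω n x) atTop ≤
      C * 20 ^ d * (limsup A atTop + ε) + ε := fun ε hε => by
    set L := limsup A atTop + ε with hL
    obtain ⟨r₁, hr₁⟩ := eventually_atTop.1
      (eventually_lt_of_limsup_lt (lt_add_of_pos_right (limsup A atTop) hε) hAb)
    set r := max r₁ N₀ with hr
    have hrN : N₀ ≤ r := le_max_right _ _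
    have hL0 : 0 ≤ L := (hA0 r).trans (hr₁ r (le_max_left _ _)).le
    have hgL : ∀ m : ℕ, r ≤ m →
        ∑ x ∈ box d (m : ℝ), f x * piOf d ω x ≤ L * (2 * m + 1) ^ d := fun m hm => by
      have h1 := (hr₁ m ((le_max_left _ _).trans hm)).le
      simp only [hA] at h1
      rw [div_le_iff₀ (by rw [card_box]; positivity), card_box] at h1
      exact_mod_cast h1
    have hnear : Tendsto (fun n : ℕ => ∑ x ∈ box d ((2 * r : ℕ) : ℝ),
        f x * piOf d ω x * avgHeat d ω n x) atTop (𝓝 0) := by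
      have := tendsto_finsetSum (box d ((2 * r : ℕ) : ℝ)) fun x _ =>
        (hμ.tendsto_avgHeat hd hp hq hpq hmom x).const_mul (f x * piOf d ω x)
      simpa using this
    refine limsup_le_of_le (IsBoundedUnder.isCoboundedUnder_le
      (isBoundedUnder_of ⟨0, fun n => Finset.sum_nonneg fun x _ =>
        mul_nonneg (hg x) (avgHeat_nonneg ω n x)⟩)) ?_
    filter_upwards [hnear.eventually_le_const hε] with n hn
    rw [← Finset.sum_filter_add_sum_filter_not (box d (n : ℝ)) (fun x => 2 * r ≤ supN x)]
    refine add_le_add ?_ (le_trans ?_ hn)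
    · set W := (box d (n : ℝ)).filter fun x => 2 * r ≤ supN x
      have hW : ∀ x ∈ W, 2 * r ≤ supN x := fun x hx => (Finset.mem_filter.1 hx).2
      have hav := sum_mul_local_average_le hg
        (fun x => mul_nonneg (piOf_nonneg ω x) (avgHeat_nonneg ω n x)) (by omega : 1 ≤ r) hL0 hgL
        (W := W) (Y := box d ((2 * n : ℕ) : ℝ)) hW
        (fun x hx y hy => by
          have h1 := mem_box.1 (Finset.mem_filter.1 hx).1
          have h2 := mem_ball.1 hy
          have h3 := supN_add_le (y - x) x
          rw [sub_add_cancel] at h3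
          exact mem_box.2 (by omega))
        (hμ.sum_avgHeat_le_one hd n _)
      rw [mul_assoc]
      refine le_trans ?_ (mul_le_mul_of_nonneg_left hav hC.le)
      rw [Finset.mul_sum]
      refine Finset.sum_le_sum fun x hx => ?_
      have h1 := hW x hx
      rw [mul_left_comm]
      exact mul_le_mul_of_nonneg_left
        (hmean n (supN x / 2) x (by omega) (by omega) (by omega)) (hg x)
    · refine Finset.sum_le_sum_of_subset_of_nonneg (fun x hx => ?_) fun x _ _ =>
        mul_nonneg (hg x) (avgHeat_nonneg ω n x)
      have := (Finset.mem_filter.1 hx).2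
      exact mem_box.2 (by omega)
  refine le_of_forall_pos_le_add fun δ hδ => ?_
  have hc : 0 < C * 20 ^ d + 1 := by positivity
  refine (hbound (δ / (C * 20 ^ d + 1)) (by positivity)).trans (le_of_eq ?_)
  field_simp
  ring

end DetCond
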